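/- arXiv:math/0310478 — 2 statements merged into one kernel-verified Lean document; each statement's English description precedes it below -/
import Mathlib

section
/- For a lattice polytope Q of dimension n with Ehrhart polynomial p, the value (-1)^n · p(-k) equals the number of interior lattice points of the dilate kQ, for every positive integer k. -/
open Pointwise

/-- The polynomial `(X + 1) ⋯ (X + n) / n!`, which takes the value `(t + n).choose n` at `t : ℕ`. -/
noncomputable def multichoosePoly (n : ℕ) : Polynomial ℚ :=
  Polynomial.C (n.factorial : ℚ)⁻¹ * (ascPochhammer ℚ n).comp (Polynomial.X + 1)

theorem multichoosePoly_eval (n : ℕ) (t : ℚ) :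
    (multichoosePoly n).eval t = (n.factorial : ℚ)⁻¹ * (ascPochhammer ℚ n).eval (t + 1) := by
  simp [multichoosePoly]

theorem multichoosePoly_eval_natCast (n t : ℕ) :
    (multichoosePoly n).eval (t : ℚ) = (t + n).choose n := by
  have h : (t : ℚ) + 1 = ((t + 1 : ℕ) : ℚ) := by push_cast; rfl
  rw [multichoosePoly_eval, h, ascPochhammer_nat_eq_natCast_ascFactorial,
    Nat.ascFactorial_eq_factorial_mul_choose]
  push_cast
  field_simp

theorem multichoosePoly_eval_of_neg (n : ℕ) (t : ℤ) (ht : t < 0) (htn : -(n : ℤ) ≤ t) :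
    (multichoosePoly n).eval (t : ℚ) = 0 := by
  obtain ⟨m, rfl⟩ : ∃ m : ℕ, t = -(m : ℤ) - 1 := ⟨(-t - 1).toNat, by omega⟩
  have h : (((-(m : ℤ) - 1 : ℤ) : ℚ) + 1) = -(m : ℚ) := by push_cast; ring
  rw [multichoosePoly_eval, h, ascPochhammer_eval_neg_coe_nat_of_lt (by omega), mul_zero]

theorem multichoosePoly_eval_reflect (n : ℕ) (t : ℚ) :
    (multichoosePoly n).eval (-t - (n + 1)) = (-1) ^ n * (multichoosePoly n).eval t := by
  have h : -t - (n + 1) + 1 = -(t + n) := by ring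
  have h' : t + n - n + 1 = t + 1 := by ring
  rw [multichoosePoly_eval, multichoosePoly_eval, h, ascPochhammer_eval_neg_eq_descPochhammer,
    descPochhammer_eval_eq_ascPochhammer, h']
  ring

theorem card_piAntidiag_univ {ι : Type*} [Fintype ι] [DecidableEq ι] {n : ℕ}
    (hι : Fintype.card ι = n + 1) (t : ℕ) :
    (Finset.piAntidiag (Finset.univ : Finset ι) t).card = (t + n).choose n := by
  rw [← Finset.map_sym_eq_piAntidiag, Finset.card_map, Finset.sym_univ, Finset.card_univ,
    Sym.card_sym_eq_choose, hι]
  have : n + 1 + t - 1 = t + n := by omega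
  rw [this, Nat.choose_symm_add]

/-- The half-open cone of the points whose coordinates are nonnegative, and positive on `I`. -/
def halfOpenCone {L ι : Type*} (c : L → ι → ℝ) (I : Set ι) : Set L :=
  {x | ∀ i, 0 ≤ c x i ∧ (i ∈ I → 0 < c x i)}

/-- The half-open fundamental parallelepiped of `halfOpenCone c I`. -/
def halfOpenBox {L ι : Type*} (c : L → ι → ℝ) (I : Set ι) : Set L :=
  {x | ∀ i, (0 ≤ c x i ∧ c x i ≤ 1) ∧ (i ∈ I → 0 < c x i) ∧ (i ∉ I → c x i < 1)}

section HalfOpen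

variable {L ι : Type*} [AddCommGroup L] [Fintype ι] [DecidableEq ι] {n : ℕ}
  {c : L →+ (ι → ℝ)} {e : ι → L} {ht : L →+ ℤ} {I : Set ι}

theorem map_add_sum_nsmul (he : ∀ i, c (e i) = Pi.single i 1) (r : L) (m : ι → ℕ) (i : ι) :
    c (r + ∑ j, m j • e j) i = c r i + m i := by
  simp [he, Finset.sum_apply, Pi.single_apply]

theorem eq_of_halfOpenBox_add_eq (he : ∀ i, c (e i) = Pi.single i 1) {r r' : L} (hr : r ∈ halfOpenBox c I)
    (hr' : r' ∈ halfOpenBox c I) {m m' : ι → ℕ}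
    (h : r + ∑ j, m j • e j = r' + ∑ j, m' j • e j) : r = r' ∧ m = m' := by
  have hc (i : ι) : c r i + m i = c r' i + m' i := by
    rw [← map_add_sum_nsmul he, ← map_add_sum_nsmul he, h]
  have hm : m = m' := by
    funext i
    obtain ⟨⟨h0, h1⟩, h2, h3⟩ := hr i
    obtain ⟨⟨h0', h1'⟩, h2', h3'⟩ := hr' i
    have := hc i
    have hlt : (m i : ℝ) < m' i + 1 ∧ (m' i : ℝ) < m i + 1 := by
      by_cases hi : i ∈ I
      · have := h2 hi; have := h2' hi; constructor <;> linarith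
      · have := h3 hi; have := h3' hi; constructor <;> linarith
    have h4 : m i < m' i + 1 := by exact_mod_cast hlt.1
    have h5 : m' i < m i + 1 := by exact_mod_cast hlt.2
    omega
  subst hm
  exact ⟨by simpa using h, rfl⟩

theorem exists_halfOpenBox_add_eq (he : ∀ i, c (e i) = Pi.single i 1) {x : L}
    (hx : x ∈ halfOpenCone c I) :
    ∃ r ∈ halfOpenBox c I, ∃ m : ι → ℕ, x = r + ∑ j, m j • e j := by
  have key (i : ι) : ∃ a : ℕ, (0 ≤ c x i - a ∧ c x i - a ≤ 1) ∧ (i ∈ I → 0 < c x i - a) ∧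
      (i ∉ I → c x i - a < 1) := by
    obtain ⟨h0, h1⟩ := hx i
    by_cases hi : i ∈ I
    · refine ⟨⌈c x i⌉₊ - 1, ?_⟩
      have hpos := Nat.ceil_pos.2 (h1 hi)
      have hle := Nat.le_ceil (c x i)
      have hlt := Nat.ceil_lt_add_one h0
      rw [Nat.cast_sub hpos]
      push_cast
      exact ⟨⟨by linarith, by linarith⟩, fun _ => by linarith, fun h => absurd hi h⟩
    · refine ⟨⌊c x i⌋₊, ?_⟩
      have hle := Nat.floor_le h0
      have hlt := Nat.lt_floor_add_one (c x i)
      exact ⟨⟨by linarith, by linarith⟩, fun h => absurd h hi, fun _ => by linarith⟩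
  choose m hm using key
  refine ⟨x - ∑ j, m j • e j, fun i => ?_, m, by simp⟩
  have h := map_add_sum_nsmul he (x - ∑ j, m j • e j) m i
  rw [sub_add_cancel] at h
  have h' : c (x - ∑ j, m j • e j) i = c x i - m i := by linarith
  rw [h']
  exact hm i

theorem ht_add_sum_nsmul (he : ∀ i, c (e i) = Pi.single i 1)
    (hht : ∀ x, (ht x : ℝ) = ∑ i, c x i) (r : L) (m : ι → ℕ) :
    ht (r + ∑ j, m j • e j) = ht r + ((∑ j, m j : ℕ) : ℤ) := by
  have h : (ht (r + ∑ j, m j • e j) : ℝ) = ht r + ((∑ j, m j : ℕ) : ℝ) := by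
    simp_rw [hht, map_add_sum_nsmul he, Finset.sum_add_distrib]
    push_cast
    rfl
  exact_mod_cast h

theorem halfOpenCone_slice_card (hι : Fintype.card ι = n + 1) (he : ∀ i, c (e i) = Pi.single i 1) (hht : ∀ x, (ht x : ℝ) = ∑ i, c x i)
    (P : Finset L) (hP : (P : Set L) = halfOpenBox c I) {k : ℕ} (hk : 0 < k) :
    {x | x ∈ halfOpenCone c I ∧ ht x = k}.Finite ∧
      ({x | x ∈ halfOpenCone c I ∧ ht x = k}.ncard : ℚ) =
        ∑ r ∈ P, (multichoosePoly n).eval ((k : ℚ) - ht r) := by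
  classical
  have memP {r : L} : r ∈ P ↔ r ∈ halfOpenBox c I := by rw [← hP, Finset.mem_coe]
  let A (r : L) : Finset (ι → ℕ) :=
    if ht r ≤ k then Finset.piAntidiag Finset.univ (k - ht r).toNat else ∅
  have memA {r : L} {m : ι → ℕ} : m ∈ A r ↔ ht r + ((∑ j, m j : ℕ) : ℤ) = k := by
    by_cases h : ht r ≤ k
    · simp only [A, h, if_true, Finset.mem_piAntidiag, Finset.mem_univ, implies_true, and_true]
      change ∑ j, m j = _ ↔ _
      omega
    · simp only [A, h, if_false, Finset.notMem_empty, false_iff]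
      omega
  have himage : {x | x ∈ halfOpenCone c I ∧ ht x = k} =
      ((P.sigma A).image fun a => a.1 + ∑ j, a.2 j • e j : Finset L) := by
    ext x
    simp only [Set.mem_ofPred_eq, Finset.coe_image, Set.mem_image, Finset.mem_coe,
      Finset.mem_sigma, memP, memA, Sigma.exists]
    constructor
    · rintro ⟨hx, hxk⟩
      obtain ⟨r, hr, m, rfl⟩ := exists_halfOpenBox_add_eq he hx
      exact ⟨r, m, ⟨hr, by rw [← hxk, ht_add_sum_nsmul he hht]⟩, rfl⟩
    · rintro ⟨r, m, ⟨hr, hm⟩, rfl⟩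
      refine ⟨fun i => ?_, by rw [ht_add_sum_nsmul he hht, hm]⟩
      rw [map_add_sum_nsmul he]
      obtain ⟨⟨h0, h1⟩, h2, h3⟩ := hr i
      have : (0 : ℝ) ≤ m i := Nat.cast_nonneg _
      exact ⟨by linarith, fun hi => by have := h2 hi; linarith⟩
  refine ⟨himage ▸ Finset.finite_toSet _, ?_⟩
  rw [himage, Set.ncard_coe_finset, Finset.card_image_of_injOn, Finset.card_sigma]
  · push_cast
    refine Finset.sum_congr rfl fun r hr => ?_
    have hr' := memP.1 hr
    have hle : ht r ≤ n + 1 := by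
      have : (ht r : ℝ) ≤ n + 1 := by
        rw [hht]
        calc ∑ i, c r i ≤ ∑ _i : ι, (1 : ℝ) := Finset.sum_le_sum fun i _ => (hr' i).1.2
          _ = n + 1 := by simp [hι]
      exact_mod_cast this
    by_cases h : ht r ≤ k
    · obtain ⟨t, ht'⟩ : ∃ t : ℕ, (k : ℤ) - ht r = t := ⟨(k - ht r).toNat, by omega⟩
      have hq : (k : ℚ) - ht r = (t : ℚ) := by exact_mod_cast ht'
      simp only [A, h, if_true]
      rw [card_piAntidiag_univ hι, hq, multichoosePoly_eval_natCast, ht', Int.toNat_natCast]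
    · have hq : (k : ℚ) - ht r = ((k - ht r : ℤ) : ℚ) := by push_cast; rfl
      rw [hq, multichoosePoly_eval_of_neg _ _ (by omega) (by omega)]
      simp [A, h]
  · rintro ⟨r, m⟩ ha ⟨r', m'⟩ ha' h
    simp only [Finset.coe_sigma, Set.mem_sigma_iff, Finset.mem_coe, memP] at ha ha'
    obtain ⟨rfl, rfl⟩ := eq_of_halfOpenBox_add_eq he ha.1 ha'.1 h
    rfl

theorem halfOpenBox_compl (he : ∀ i, c (e i) = Pi.single i 1) (r : L) :
    ∑ j, e j - r ∈ halfOpenBox c Iᶜ ↔ r ∈ halfOpenBox c I := by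
  have h (i : ι) : c (∑ j, e j - r) i = 1 - c r i := by
    simp [he, Finset.sum_apply, Pi.single_apply]
  refine forall_congr' fun i => ?_
  rw [h]
  by_cases hi : i ∈ I
  · simp [hi]; tauto
  · simp [hi]; tauto

/-- Reciprocity for half-open simplicial cones. -/
theorem halfOpenCone_reciprocity (hι : Fintype.card ι = n + 1) (he : ∀ i, c (e i) = Pi.single i 1) (hht : ∀ x, (ht x : ℝ) = ∑ i, c x i)
    (hfin : {x | ∀ i, c x i ∈ Set.Icc 0 1}.Finite) (I : Set ι) :
    ∃ f : Polynomial ℚ, ∀ k : ℕ, 0 < k →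
      ({x | x ∈ halfOpenCone c I ∧ ht x = k}.Finite ∧
        f.eval (k : ℚ) = {x | x ∈ halfOpenCone c I ∧ ht x = k}.ncard) ∧
      ({x | x ∈ halfOpenCone c Iᶜ ∧ ht x = k}.Finite ∧
        (-1) ^ n * f.eval (-k : ℚ) = {x | x ∈ halfOpenCone c Iᶜ ∧ ht x = k}.ncard) := by
  classical
  have hbox : (halfOpenBox c I).Finite := hfin.subset fun x hx i => (hx i).1
  let P := hbox.toFinset
  have hP : (P : Set L) = halfOpenBox c I := hbox.coe_toFinset
  have hP' : ((P.image fun r => ∑ j, e j - r : Finset L) : Set L) = halfOpenBox c Iᶜ := by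
    ext x
    rw [Finset.coe_image, hP]
    constructor
    · rintro ⟨r, hr, rfl⟩
      exact (halfOpenBox_compl he r).2 hr
    · intro hx
      refine ⟨∑ j, e j - x, ?_, by simp⟩
      rwa [← halfOpenBox_compl he, sub_sub_cancel]
  refine ⟨∑ r ∈ P, (multichoosePoly n).comp (Polynomial.X - Polynomial.C (ht r : ℚ)),
    fun k hk => ?_⟩
  obtain ⟨h1, h2⟩ := halfOpenCone_slice_card hι he hht P hP hk
  obtain ⟨h3, h4⟩ := halfOpenCone_slice_card hι he hht _ hP' hk
  refine ⟨⟨h1, ?_⟩, h3, ?_⟩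
  · rw [h2, Polynomial.eval_finsetSum]
    simp
  · rw [h4, Polynomial.eval_finsetSum, Finset.sum_image (fun a _ b _ h => by simpa using h),
      Finset.mul_sum]
    refine Finset.sum_congr rfl fun r _ => ?_
    have hte : ht (∑ j, e j) = n + 1 := by
      have : (ht (∑ j, e j) : ℝ) = n + 1 := by
        rw [hht]
        simp [he, Finset.sum_apply, Pi.single_apply, hι]
      exact_mod_cast this
    have hq : (k : ℚ) - (ht (∑ j, e j - r) : ℤ) = -(-k - ht r) - (n + 1) := by
      rw [map_sub, hte]; push_cast; ring
    rw [hq, multichoosePoly_eval_reflect]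
    simp

end HalfOpen

section Triangulation

open Module Filter Topology

variable {E ι : Type*} [NormedAddCommGroup E] [NormedSpace ℝ E]

/-- The convex cone generated by a finite family. -/
def posCone [Fintype ι] (w : ι → E) : Set E :=
  {x | ∃ a : ι → ℝ, (∀ i, 0 ≤ a i) ∧ ∑ i, a i • w i = x}

/-- A vector lying in no proper subspace spanned by members of the family `w`. -/
def IsGenericVector (w : ι → E) (d : E) : Prop :=
  ∀ F : Finset ι, Submodule.span ℝ (w '' F) ≠ ⊤ → d ∉ Submodule.span ℝ (w '' F)

/-- A height function whose graph over `w` has no point on a hyperplane through a lifted basis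
other than the members of that basis. -/
def IsGenericHeight (w : ι → E) (h : ι → ℝ) : Prop :=
  ∀ (S : Finset ι) (b : Basis S ℝ E), (∀ s, b s = w s) →
    ∀ v ∉ S, b.constr ℝ (fun s => h s) (w v) ≠ h v

/-- `S` spans a maximal cell of the regular triangulation of `posCone w` induced by `h`. -/
def IsCell (w : ι → E) (h : ι → ℝ) (S : Finset ι) : Prop :=
  ∃ b : Basis S ℝ E, (∀ s, b s = w s) ∧ ∀ v ∉ S, b.constr ℝ (fun s => h s) (w v) < h v

theorem exists_isGenericVector [Finite ι] (w : ι → E) : ∃ d, IsGenericVector w d := by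
  obtain ⟨d, hd⟩ := Submodule.exists_forall_notMem_of_forall_ne_top
    (fun F : {F : Finset ι // Submodule.span ℝ (w '' F) ≠ ⊤} => Submodule.span ℝ (w '' F.1))
    fun F => F.2
  exact ⟨d, fun F hF => hd ⟨F, hF⟩⟩

theorem IsGenericVector.neg {w : ι → E} {d : E} (hd : IsGenericVector w d) :
    IsGenericVector w (-d) :=
  fun F hF h => hd F hF (by simpa using h)

theorem exists_isGenericHeight [Finite ι] (w : ι → E) : ∃ h, IsGenericHeight w h := by
  classical
  let J := {p : Finset ι × ι // p.2 ∉ p.1 ∧ ∃ b : Basis p.1 ℝ E, ∀ s, b s = w s}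
  choose b hb using fun p : J => p.2.2
  let f (p : J) : Dual ℝ (ι → ℝ) :=
    LinearMap.proj p.1.2 - ∑ s, (b p).repr (w p.1.2) s • LinearMap.proj (s : ι)
  obtain ⟨h, hh⟩ := Dual.exists_forall_ne_zero_of_forall_exists f fun p => by
    refine ⟨Pi.single p.1.2 1, ?_⟩
    have h0 (s : p.1.1) : (s : ι) ≠ p.1.2 := fun h => p.2.1 (h ▸ s.2)
    simp [f, h0]
  refine ⟨h, fun S b' hb' v hv heq => hh ⟨(S, v), hv, b', hb'⟩ ?_⟩
  have hbb : b ⟨(S, v), hv, b', hb'⟩ = b' := Basis.eq_of_apply_eq fun s => by rw [hb, hb']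
  simp only [f, hbb, LinearMap.sub_apply, LinearMap.sum_apply, LinearMap.smul_apply,
    LinearMap.proj_apply, smul_eq_mul]
  rw [← heq, Basis.constr_apply_fintype]
  simp [Basis.equivFun_apply]

theorem eventually_isGenericVector_add_smul [Finite ι] {w : ι → E} {d : E}
    (hd : IsGenericVector w d) (x : E) :
    ∀ᶠ ε : ℝ in 𝓝[>] 0, IsGenericVector w (x + ε • d) := by
  unfold IsGenericVector
  rw [eventually_all]
  intro F
  by_cases hF : Submodule.span ℝ (w '' F) = ⊤
  · simp [hF]
  have hsub : {ε : ℝ | x + ε • d ∈ Submodule.span ℝ (w '' F)}.Subsingleton := by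
    intro a ha b hb
    by_contra hab
    have h1 : (a - b) • d ∈ Submodule.span ℝ (w '' F) := by
      have ha' : x + a • d ∈ Submodule.span ℝ (w '' F) := ha
      have hb' : x + b • d ∈ Submodule.span ℝ (w '' F) := hb
      have := Submodule.sub_mem _ ha' hb'
      rwa [add_sub_add_left_eq_sub, ← sub_smul] at this
    exact hd F hF ((Submodule.smul_mem_iff _ (sub_ne_zero.2 hab)).1 h1)
  filter_upwards [(nhdsGT_le_nhdsNE 0).trans (nhdsNE_le_cofinite 0)
    hsub.finite.compl_mem_cofinite] with ε hε _ using hε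

theorem exists_basis_subset [Finite ι] {w : ι → E} {F : Finset ι}
    (hF : Submodule.span ℝ (w '' F) = ⊤) :
    ∃ S ⊆ F, ∃ b : Basis S ℝ E, ∀ s, b s = w s := by
  classical
  obtain ⟨S, hSF, -, hspan, hli⟩ := exists_linearIndepOn_extension (K := ℝ) (v := w)
    (linearIndepOn_empty ℝ w) (Set.empty_subset (F : Set ι))
  have : Fintype ι := Fintype.ofFinite ι
  lift S to Finset ι using S.toFinite
  refine ⟨S, by exact_mod_cast hSF, Basis.mk (v := fun s : S => w s) (by exact hli) ?_,
    fun s => Basis.mk_apply _ _ s⟩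
  rw [← hF, Submodule.span_le]
  have : Set.range (fun s : S => w s) = w '' S := by
    ext; simp
  rwa [this]

theorem posCone_add_mem [Fintype ι] {w : ι → E} {x y : E} (hx : x ∈ posCone w)
    (hy : y ∈ posCone w) : x + y ∈ posCone w := by
  obtain ⟨a, ha, rfl⟩ := hx
  obtain ⟨b, hb, rfl⟩ := hy
  exact ⟨a + b, fun i => add_nonneg (ha i) (hb i), by simp [add_smul, Finset.sum_add_distrib]⟩

theorem posCone_smul_mem [Fintype ι] {w : ι → E} {x : E} (hx : x ∈ posCone w) {r : ℝ}
    (hr : 0 ≤ r) : r • x ∈ posCone w := by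
  obtain ⟨a, ha, rfl⟩ := hx
  exact ⟨r • a, fun i => mul_nonneg hr (ha i), by simp [mul_smul, Finset.smul_sum]⟩

/-- The coordinates of `S` extended by zero represent a vector in terms of `w`. -/
theorem sum_extend_repr_smul [Fintype ι] [DecidableEq ι] {w : ι → E} {S : Finset ι}
    (b : Basis S ℝ E) (hb : ∀ s, b s = w s) (x : E) :
    ∑ i, (if h : i ∈ S then b.repr x ⟨i, h⟩ else 0) • w i = x := by
  have h1 : ∑ i, (if h : i ∈ S then b.repr x ⟨i, h⟩ else 0) • w i =
      ∑ i ∈ S, (if h : i ∈ S then b.repr x ⟨i, h⟩ else 0) • w i := by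
    refine (Finset.sum_subset (Finset.subset_univ S) fun i _ hi => ?_).symm
    simp [hi]
  rw [h1, ← Finset.sum_coe_sort]
  conv_rhs => rw [← b.sum_repr x]
  exact Finset.sum_congr rfl fun s _ => by simp [hb]

theorem sum_extend_repr_mul [Fintype ι] [DecidableEq ι] {S : Finset ι}
    (b : Basis S ℝ E) (h : ι → ℝ) (x : E) :
    ∑ i, (if hi : i ∈ S then b.repr x ⟨i, hi⟩ else 0) * h i = b.constr ℝ (fun s => h s) x := by
  have h1 : ∑ i, (if h : i ∈ S then b.repr x ⟨i, h⟩ else 0) * h i =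
      ∑ i ∈ S, (if h : i ∈ S then b.repr x ⟨i, h⟩ else 0) * h i := by
    refine (Finset.sum_subset (Finset.subset_univ S) fun i _ hi => ?_).symm
    simp [hi]
  rw [h1, ← Finset.sum_coe_sort, Basis.constr_apply_fintype]
  exact Finset.sum_congr rfl fun s _ => by simp [Basis.equivFun_apply]

theorem mem_posCone_of_repr_nonneg [Fintype ι] {w : ι → E} {S : Finset ι}
    (b : Basis S ℝ E) (hb : ∀ s, b s = w s) {x : E} (hx : ∀ s, 0 ≤ b.repr x s) :
    x ∈ posCone w := by
  classical
  refine ⟨_, fun i => ?_, sum_extend_repr_smul b hb x⟩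
  split_ifs
  exacts [hx _, le_rfl]

/-- A feasible nonnegative representation of minimal height. -/
theorem exists_isMinOn_height [Fintype ι] {w : ι → E} {ht : E →ₗ[ℝ] ℝ} (hw : ∀ i, ht (w i) = 1)
    (h : ι → ℝ) {y : E} (hy : y ∈ posCone w) :
    ∃ a : ι → ℝ, ((∀ i, 0 ≤ a i) ∧ ∑ i, a i • w i = y) ∧
      ∀ a' : ι → ℝ, (∀ i, 0 ≤ a' i) → ∑ i, a' i • w i = y → ∑ i, a i * h i ≤ ∑ i, a' i * h i := by
  let K : Set (ι → ℝ) := {a | (∀ i, 0 ≤ a i) ∧ ∑ i, a i • w i = y}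
  have hK : IsCompact K := by
    refine (isCompact_Icc (a := (0 : ι → ℝ)) (b := fun _ => ht y)).of_isClosed_subset ?_ ?_
    · have h1 : IsClosed {a : ι → ℝ | ∀ i, 0 ≤ a i} := by
        simp only [Set.ofPred_forall]
        exact isClosed_iInter fun i => isClosed_le continuous_const (continuous_apply i)
      exact h1.inter (isClosed_eq (by fun_prop) continuous_const)
    · rintro a ⟨ha, rfl⟩
      refine ⟨ha, fun i => ?_⟩
      simp only [map_sum, map_smul, hw, smul_eq_mul, mul_one]
      exact Finset.single_le_sum (fun j _ => ha j) (Finset.mem_univ i)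
  obtain ⟨a, ha, hmin⟩ := hK.exists_isMinOn (f := fun a => ∑ i, a i * h i) hy (by fun_prop)
  exact ⟨a, ha, fun a' h1 h2 => hmin ⟨h1, h2⟩⟩

theorem exists_isCell_repr_pos [Fintype ι] {w : ι → E} {ht : E →ₗ[ℝ] ℝ} (hw : ∀ i, ht (w i) = 1)
    {h : ι → ℝ} (hh : IsGenericHeight w h) {y : E} (hy : y ∈ posCone w)
    (hgen : IsGenericVector w y) :
    ∃ S, IsCell w h S ∧ ∃ b : Basis S ℝ E, (∀ s, b s = w s) ∧ ∀ s, 0 < b.repr y s := by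
  classical
  obtain ⟨a, ⟨ha, hay⟩, hmin⟩ := exists_isMinOn_height hw h hy
  let F : Finset ι := {i | 0 < a i}
  have memF {i : ι} : i ∈ F ↔ 0 < a i := by simp [F]
  have hspan : Submodule.span ℝ (w '' F) = ⊤ := by
    by_contra hne
    refine hgen F hne ?_
    rw [← hay]
    refine Submodule.sum_mem _ fun i _ => ?_
    rcases (ha i).eq_or_lt with h0 | h0
    · simp [← h0]
    · exact Submodule.smul_mem _ _ (Submodule.subset_span ⟨i, memF.2 h0, rfl⟩)
  obtain ⟨S, hSF, b, hb⟩ := exists_basis_subset hspan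
  let u (v i : ι) : ℝ := Pi.single (M := fun _ => ℝ) v 1 i -
    if hi : i ∈ S then b.repr (w v) ⟨i, hi⟩ else 0
  have hu (v : ι) : ∑ i, u v i • w i = 0 := by
    simp only [u, sub_smul, Finset.sum_sub_distrib, sum_extend_repr_smul b hb]
    simp [Pi.single_apply]
  have huh (v : ι) : ∑ i, u v i * h i = h v - b.constr ℝ (fun s => h s) (w v) := by
    simp only [u, sub_mul, Finset.sum_sub_distrib, sum_extend_repr_mul b h]
    simp [Pi.single_apply]
  have step (v : ι) (τ : ℝ) (hτ : ∀ᶠ ε : ℝ in 𝓝[>] 0, ∀ i, 0 ≤ a i + ε * (τ * u v i)) :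
      0 ≤ τ * (h v - b.constr ℝ (fun s => h s) (w v)) := by
    obtain ⟨ε, hε, hpos⟩ := (hτ.and self_mem_nhdsWithin).exists
    have hpos : (0 : ℝ) < ε := hpos
    have := hmin (fun i => a i + ε * (τ * u v i)) hε (by
      simp only [add_smul, Finset.sum_add_distrib, hay, mul_smul, ← Finset.smul_sum, hu,
        smul_zero, add_zero])
    simp only [add_mul, Finset.sum_add_distrib, mul_assoc, ← Finset.mul_sum, huh] at this
    have h2 : 0 ≤ ε * (τ * (h v - b.constr ℝ (fun s => h s) (w v))) := by linarith
    exact nonneg_of_mul_nonneg_right h2 hpos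
  have small (i : ι) (hi : 0 < a i) (r : ℝ) : ∀ᶠ ε : ℝ in 𝓝[>] 0, 0 ≤ a i + ε * r := by
    have : Tendsto (fun ε : ℝ => a i + ε * r) (𝓝[>] 0) (𝓝 (a i + 0 * r)) :=
      (Continuous.tendsto (by fun_prop) 0).mono_left nhdsWithin_le_nhds
    rw [zero_mul, add_zero] at this
    exact (this.eventually (lt_mem_nhds hi)).mono fun _ => le_of_lt
  have huS {v i : ι} (hi : i ∉ S) (hiv : i ≠ v) : u v i = 0 := by simp [u, hi, hiv]
  have huv {v : ι} (hv : v ∉ S) : u v v = 1 := by simp [u, hv]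
  have hle (v : ι) (hv : v ∉ S) : b.constr ℝ (fun s => h s) (w v) ≤ h v := by
    have := step v 1 (eventually_all.2 fun i => by
      by_cases hi : i ∈ S
      · exact small i (memF.1 (hSF hi)) _
      · filter_upwards [self_mem_nhdsWithin] with ε hε
        have hε : (0 : ℝ) < ε := hε
        have := ha i
        by_cases hiv : i = v
        · subst hiv; rw [huv hv]; linarith
        · rw [huS hi hiv]; linarith)
    linarith
  have hFS : F = S := by
    refine (Finset.Subset.antisymm hSF fun v hvF => ?_).symm
    by_contra hv
    have := step v (-1) (eventually_all.2 fun i => by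
      by_cases hi : 0 < a i
      · exact small i hi _
      · have hiS : i ∉ S := fun h => hi (memF.1 (hSF h))
        have hiv : i ≠ v := fun h => hi (h ▸ memF.1 hvF)
        simp [huS hiS hiv, ha i])
    exact hh S b hb v hv (le_antisymm (hle v hv) (by linarith))
  refine ⟨S, ⟨b, hb, fun v hv => (hle v hv).lt_of_ne (hh S b hb v hv)⟩, b, hb, fun s => ?_⟩
  have hyS : y = ∑ s : S, a s • b s := by
    rw [← hay]
    simp only [hb]
    rw [Finset.sum_coe_sort S fun i => a i • w i]
    refine (Finset.sum_subset (Finset.subset_univ S) fun i _ hi => ?_).symm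
    have : a i = 0 := le_antisymm (not_lt.1 fun h => hi (hFS ▸ memF.2 h)) (ha i)
    simp [this]
  rw [hyS, Basis.repr_sum_self]
  exact memF.1 (hSF s.2)

theorem constr_le_constr_of_repr_pos [Fintype ι] {w : ι → E} {h : ι → ℝ} {S S' : Finset ι}
    {b : Basis S ℝ E} {b' : Basis S' ℝ E} (hb : ∀ s, b s = w s) (hb' : ∀ s, b' s = w s)
    (hcell : ∀ v ∉ S, b.constr ℝ (fun s => h s) (w v) < h v) {y : E}
    (hy : ∀ s, 0 < b'.repr y s) :
    b.constr ℝ (fun s => h s) y ≤ b'.constr ℝ (fun s => h s) y ∧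
      (¬ S' ⊆ S → b.constr ℝ (fun s => h s) y < b'.constr ℝ (fun s => h s) y) := by
  have hS (s : S') : b.constr ℝ (fun s => h s) (b' s) ≤ h s := by
    rw [hb']
    by_cases hs : (s : ι) ∈ S
    · have : w s = b ⟨s, hs⟩ := (hb ⟨s, hs⟩).symm
      rw [this, Basis.constr_basis]
    · exact (hcell s hs).le
  have h1 : b.constr ℝ (fun s => h s) y =
      ∑ s, b'.repr y s * b.constr ℝ (fun s => h s) (b' s) := by
    conv_lhs => rw [← b'.sum_repr y]
    simp only [map_sum, map_smul, smul_eq_mul]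
  have h2 : b'.constr ℝ (fun s => h s) y = ∑ s, b'.repr y s * h s := by
    simp [Basis.constr_apply_fintype, Basis.equivFun_apply]
  rw [h1, h2]
  refine ⟨Finset.sum_le_sum fun s _ => mul_le_mul_of_nonneg_left (hS s) (hy s).le, fun hsub => ?_⟩
  obtain ⟨v, hv, hvS⟩ := Finset.not_subset.1 hsub
  refine Finset.sum_lt_sum (fun s _ => mul_le_mul_of_nonneg_left (hS s) (hy s).le)
    ⟨⟨v, hv⟩, Finset.mem_univ _, mul_lt_mul_of_pos_left ?_ (hy _)⟩
  rw [hb']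
  exact hcell v hvS

theorem isCell_eq_of_repr_pos [Fintype ι] {w : ι → E} {h : ι → ℝ} {S S' : Finset ι}
    {b : Basis S ℝ E} {b' : Basis S' ℝ E} (hb : ∀ s, b s = w s) (hb' : ∀ s, b' s = w s)
    (hcell : ∀ v ∉ S, b.constr ℝ (fun s => h s) (w v) < h v)
    (hcell' : ∀ v ∉ S', b'.constr ℝ (fun s => h s) (w v) < h v) {y : E}
    (hy : ∀ s, 0 < b.repr y s) (hy' : ∀ s, 0 < b'.repr y s) : S = S' := by
  obtain ⟨h1, h2⟩ := constr_le_constr_of_repr_pos hb hb' hcell hy'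
  obtain ⟨h3, h4⟩ := constr_le_constr_of_repr_pos hb' hb hcell' hy
  refine Finset.Subset.antisymm ?_ ?_
  · by_contra hne
    have := h4 hne
    linarith
  · by_contra hne
    have := h2 hne
    linarith

end Triangulation

section Decomposition

open Module Filter Topology

theorem eventually_add_mul_pos {α β : ℝ} (h0 : 0 ≤ α) (h : β < 0 → 0 < α) (hβ : β ≠ 0) :
    ∀ᶠ ε : ℝ in 𝓝[>] 0, 0 < α + ε * β := by
  rcases h0.eq_or_lt with rfl | hα
  · have hβ' : 0 < β := lt_of_le_of_ne (not_lt.1 fun hb => lt_irrefl _ (h hb)) hβ.symm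
    filter_upwards [self_mem_nhdsWithin] with ε hε
    have hε : (0 : ℝ) < ε := hε
    positivity
  · have : Tendsto (fun ε : ℝ => α + ε * β) (𝓝[>] 0) (𝓝 (α + 0 * β)) :=
      (Continuous.tendsto (by fun_prop) 0).mono_left nhdsWithin_le_nhds
    rw [zero_mul, add_zero] at this
    exact this.eventually (lt_mem_nhds hα)

theorem nonneg_of_frequently_add_mul_pos {α β : ℝ}
    (h : ∃ᶠ ε : ℝ in 𝓝[>] 0, 0 < α + ε * β) : 0 ≤ α ∧ (β < 0 → 0 < α) := by
  have h0 : 0 ≤ α := by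
    by_contra hα
    refine h ?_
    have : Tendsto (fun ε : ℝ => α + ε * β) (𝓝[>] 0) (𝓝 (α + 0 * β)) :=
      (Continuous.tendsto (by fun_prop) 0).mono_left nhdsWithin_le_nhds
    rw [zero_mul, add_zero] at this
    exact (this.eventually (gt_mem_nhds (not_le.1 hα))).mono fun _ => not_lt_of_gt
  refine ⟨h0, fun hβ => ?_⟩
  obtain ⟨ε, hε, hpos⟩ := (h.and_eventually self_mem_nhdsWithin).exists
  have hpos : (0 : ℝ) < ε := hpos
  nlinarith

variable {E ι : Type*} [NormedAddCommGroup E] [NormedSpace ℝ E] {w : ι → E} {d : E}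

theorem IsGenericVector.repr_ne_zero (hd : IsGenericVector w d) {S : Finset ι}
    {b : Basis S ℝ E} (hb : ∀ s, b s = w s) (s : S) : b.repr d s ≠ 0 := by
  classical
  intro h0
  have hker : Submodule.span ℝ (w '' (S.erase s : Finset ι)) ≤ LinearMap.ker (b.coord s) := by
    rw [Submodule.span_le]
    rintro _ ⟨i, hi, rfl⟩
    have hi' := Finset.mem_erase.1 (Finset.mem_coe.1 hi)
    have hs : (⟨i, hi'.2⟩ : S) ≠ s := fun h => hi'.1 (congrArg Subtype.val h)
    rw [← hb ⟨i, hi'.2⟩]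
    simp [hs.symm]
  refine hd (S.erase s) (fun htop => ?_) ?_
  · have : b s ∈ LinearMap.ker (b.coord s) := hker (htop ▸ Submodule.mem_top)
    simp at this
  · rw [← b.sum_repr d]
    refine Submodule.sum_mem _ fun t _ => ?_
    by_cases hts : t = s
    · simp [hts, h0]
    · refine Submodule.smul_mem _ _ (Submodule.subset_span ⟨t, ?_, (hb t).symm⟩)
      exact Finset.mem_coe.2 (Finset.mem_erase.2 ⟨fun h => hts (Subtype.ext h), t.2⟩)

theorem mem_halfOpenCone_iff_eventually (hd : IsGenericVector w d) {S : Finset ι}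
    {b : Basis S ℝ E} (hb : ∀ s, b s = w s) {x : E} :
    x ∈ halfOpenCone b.equivFun {s | b.repr d s < 0} ↔
      ∀ᶠ ε : ℝ in 𝓝[>] 0, ∀ s, 0 < b.repr (x + ε • d) s := by
  have hr (ε : ℝ) (s : S) : b.repr (x + ε • d) s = b.repr x s + ε * b.repr d s := by simp
  simp only [hr, eventually_all]
  refine forall_congr' fun s => ?_
  simp only [Basis.equivFun_apply, Set.mem_ofPred_eq]
  exact ⟨fun h => eventually_add_mul_pos h.1 h.2 (hd.repr_ne_zero hb s),
    fun h => nonneg_of_frequently_add_mul_pos h.frequently⟩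

theorem mem_halfOpenCone_of_frequently {S : Finset ι} {b : Basis S ℝ E} {x : E}
    (h : ∃ᶠ ε : ℝ in 𝓝[>] 0, ∀ s, 0 < b.repr (x + ε • d) s) :
    x ∈ halfOpenCone b.equivFun {s | b.repr d s < 0} := by
  have hr (ε : ℝ) (s : S) : b.repr (x + ε • d) s = b.repr x s + ε * b.repr d s := by simp
  simp only [hr] at h
  exact fun s => nonneg_of_frequently_add_mul_pos (h.mono fun ε hε => hε s)

theorem exists_isGenericVector_mem_interior [Finite ι] (w : ι → E) {C : Set E}
    (hC : (interior C).Nonempty) : ∃ q ∈ interior C, IsGenericVector w q := by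
  obtain ⟨d, hd⟩ := exists_isGenericVector w
  obtain ⟨q₀, hq₀⟩ := hC
  have ht : Tendsto (fun ε : ℝ => q₀ + ε • d) (𝓝[>] 0) (𝓝 (q₀ + (0 : ℝ) • d)) :=
    (Continuous.tendsto (by fun_prop) 0).mono_left nhdsWithin_le_nhds
  rw [zero_smul, add_zero] at ht
  obtain ⟨ε, h1, h2⟩ := ((ht.eventually (isOpen_interior.mem_nhds hq₀)).and
    (eventually_isGenericVector_add_smul hd q₀)).exists
  exact ⟨_, h1, h2⟩

variable [Fintype ι] {ht : E →ₗ[ℝ] ℝ} {h : ι → ℝ}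
  {b : ∀ S : {S // IsCell w h S}, Basis S.1 ℝ E}

theorem eventually_mem_posCone_iff (hw : ∀ i, ht (w i) = 1) (hh : IsGenericHeight w h)
    (hd : IsGenericVector w d) (hb : ∀ S s, b S s = w s) {x : E} :
    (∀ᶠ ε : ℝ in 𝓝[>] 0, x + ε • d ∈ posCone w) ↔
      ∃ S, x ∈ halfOpenCone (b S).equivFun {s | (b S).repr d s < 0} := by
  constructor
  · intro hx
    by_contra! hcon
    have hev : ∀ᶠ ε : ℝ in 𝓝[>] 0, ∀ S, ¬ ∀ s, 0 < (b S).repr (x + ε • d) s :=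
      eventually_all.2 fun S => by
        by_contra hfr
        exact hcon S (mem_halfOpenCone_of_frequently hfr)
    obtain ⟨ε, ⟨h1, h2⟩, h3⟩ :=
      ((hx.and (eventually_isGenericVector_add_smul hd x)).and hev).exists
    obtain ⟨S, hS, b', hb', hpos⟩ := exists_isCell_repr_pos hw hh h1 h2
    have : b' = b ⟨S, hS⟩ := Basis.eq_of_apply_eq fun s => by rw [hb', hb]
    exact h3 ⟨S, hS⟩ (this ▸ hpos)
  · rintro ⟨S, hS⟩
    filter_upwards [(mem_halfOpenCone_iff_eventually hd (hb S)).1 hS] with ε hε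
    exact mem_posCone_of_repr_nonneg (b S) (hb S) fun s => (hε s).le

theorem halfOpenCone_cell_unique (hd : IsGenericVector w d) (hb : ∀ S s, b S s = w s)
    (hcell : ∀ S, ∀ v ∉ S.1, (b S).constr ℝ (fun s => h s) (w v) < h v)
    {x : E} {S S' : {S // IsCell w h S}}
    (hS : x ∈ halfOpenCone (b S).equivFun {s | (b S).repr d s < 0})
    (hS' : x ∈ halfOpenCone (b S').equivFun {s | (b S').repr d s < 0}) : S = S' := by
  obtain ⟨ε, h1, h2⟩ := (((mem_halfOpenCone_iff_eventually hd (hb S)).1 hS).and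
    ((mem_halfOpenCone_iff_eventually hd (hb S')).1 hS')).exists
  exact Subtype.ext (isCell_eq_of_repr_pos (hb S) (hb S') (hcell S) (hcell S') h1 h2)

theorem mem_interior_posCone_iff {q x : E} (hq : q ∈ interior (posCone w)) :
    x ∈ interior (posCone w) ↔ ∀ᶠ ε : ℝ in 𝓝[>] 0, x + ε • -q ∈ posCone w := by
  constructor
  · intro hx
    have ht : Tendsto (fun ε : ℝ => x + ε • -q) (𝓝[>] 0) (𝓝 (x + (0 : ℝ) • -q)) :=
      (Continuous.tendsto (by fun_prop) 0).mono_left nhdsWithin_le_nhds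
    rw [zero_smul, add_zero] at ht
    exact (ht.eventually (isOpen_interior.mem_nhds hx)).mono fun _ h => interior_subset h
  · intro hx
    obtain ⟨ε, h1, hε⟩ := (hx.and self_mem_nhdsWithin).exists
    have hε : (0 : ℝ) < ε := hε
    let g : E → E := fun y => ε⁻¹ • (y - (x + ε • -q))
    have hg : Continuous g := by fun_prop
    have hgx : g x = q := by
      simp only [g, smul_neg]
      rw [← sub_eq_add_neg, sub_sub_cancel, smul_smul, inv_mul_cancel₀ hε.ne', one_smul]
    refine mem_interior.2 ⟨g ⁻¹' interior (posCone w), fun y hy => ?_,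
      isOpen_interior.preimage hg, by rwa [Set.mem_preimage, hgx]⟩
    have h2 := posCone_add_mem h1 (posCone_smul_mem (interior_subset hy) hε.le)
    simp only [g, smul_smul, mul_inv_cancel₀ hε.ne', one_smul] at h2
    rwa [add_sub_cancel] at h2

/-- Ehrhart reciprocity for the cone over a lattice polytope, graded by height. -/
theorem posCone_reciprocity [FiniteDimensional ℝ E] {L : Type*} [AddCommGroup L] {n : ℕ}
    (hrank : finrank ℝ E = n + 1) (hw : ∀ i, ht (w i) = 1)
    (hne : (interior (posCone w)).Nonempty) {j : L →+ E}
    (hdisc : ∀ B, Bornology.IsBounded B → (j ⁻¹' B).Finite) {htL : L →+ ℤ}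
    (hht : ∀ x, (htL x : ℝ) = ht (j x)) {e : ι → L} (he : ∀ i, j (e i) = w i) :
    ∃ f : Polynomial ℚ, ∀ k : ℕ, 0 < k →
      f.eval (k : ℚ) = {x | j x ∈ posCone w ∧ htL x = k}.ncard ∧
      (-1) ^ n * f.eval (-k : ℚ) = {x | j x ∈ interior (posCone w) ∧ htL x = k}.ncard := by
  classical
  obtain ⟨q, hq, hgen⟩ := exists_isGenericVector_mem_interior w hne
  obtain ⟨h, hh⟩ := exists_isGenericHeight w
  choose b hb hcell using fun S : {S // IsCell w h S} => S.2
  let c (S : {S // IsCell w h S}) : L →+ (S.1 → ℝ) :=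
    ((b S).equivFun : E →+ (S.1 → ℝ)).comp j
  have key (S : {S // IsCell w h S}) := halfOpenCone_reciprocity (n := n) (c := c S) (ht := htL)
    (e := fun s => e s)
    (by rw [← finrank_eq_card_basis (b S), hrank])
    (fun s => by
      ext t
      simp [c, he, ← hb S, Pi.single_apply, eq_comm])
    (fun x => by
      rw [hht]
      conv_lhs => rw [← (b S).sum_equivFun (j x)]
      simp [hb, hw, c])
    (by
      have hcpt : IsCompact ((b S).equivFun.symm '' Set.Icc 0 1) :=
        isCompact_Icc.image (b S).equivFun.symm.toLinearMap.continuous_of_finiteDimensional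
      refine (hdisc _ hcpt.isBounded).subset fun x hx => ?_
      exact ⟨(b S).equivFun (j x), ⟨fun s => (hx s).1, fun s => (hx s).2⟩,
        (b S).equivFun.symm_apply_apply _⟩)
    {s | (b S).repr q s < 0}
  choose f hf using key
  have hcompl (S : {S // IsCell w h S}) :
      {s | (b S).repr (-q) s < 0} = {s | (b S).repr q s < 0}ᶜ := by
    ext s
    have := hgen.repr_ne_zero (hb S) s
    simp [this.symm.le_iff_lt]
  have hclosed (k : ℕ) : {x | j x ∈ posCone w ∧ htL x = k} =
      ⋃ S, {x | x ∈ halfOpenCone (c S) {s | (b S).repr q s < 0} ∧ htL x = k} := by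
    ext x
    simp only [Set.mem_iUnion, Set.mem_ofPred_eq, exists_and_right]
    refine and_congr_left fun _ => ⟨fun hx => ?_, fun ⟨S, hS⟩ => ?_⟩
    · refine (eventually_mem_posCone_iff hw hh hgen hb).1 ?_
      filter_upwards [self_mem_nhdsWithin] with ε hε
      exact posCone_add_mem hx (posCone_smul_mem (interior_subset hq) (le_of_lt hε))
    · exact mem_posCone_of_repr_nonneg (b S) (hb S) fun s => (hS s).1
  have hopen (k : ℕ) : {x | j x ∈ interior (posCone w) ∧ htL x = k} =
      ⋃ S, {x | x ∈ halfOpenCone (c S) {s | (b S).repr q s < 0}ᶜ ∧ htL x = k} := by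
    ext x
    simp only [Set.mem_iUnion, Set.mem_ofPred_eq, exists_and_right]
    refine and_congr_left fun _ => ?_
    rw [mem_interior_posCone_iff hq, eventually_mem_posCone_iff hw hh hgen.neg hb]
    simp only [hcompl]
    rfl
  have hdis {d : E} (hd : IsGenericVector w d) (k : ℕ) : Pairwise fun S S' =>
      Disjoint {x | x ∈ halfOpenCone (c S) {s | (b S).repr d s < 0} ∧ htL x = k}
        {x | x ∈ halfOpenCone (c S') {s | (b S').repr d s < 0} ∧ htL x = k} :=
    fun S S' hne => Set.disjoint_left.2 fun x hx hx' =>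
      hne (halfOpenCone_cell_unique hd hb hcell hx.1 hx'.1)
  refine ⟨∑ S, f S, fun k hk => ⟨?_, ?_⟩⟩
  · rw [hclosed, Set.ncard_iUnion_of_finite (fun S => (hf S k hk).1.1) (hdis hgen k),
      finsum_eq_sum_of_fintype, Polynomial.eval_finsetSum]
    push_cast
    exact Finset.sum_congr rfl fun S _ => (hf S k hk).1.2
  · have hdis' := hdis hgen.neg k
    simp only [hcompl] at hdis'
    rw [hopen, Set.ncard_iUnion_of_finite (fun S => (hf S k hk).2.1) hdis',
      finsum_eq_sum_of_fintype, Polynomial.eval_finsetSum, Finset.mul_sum]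
    push_cast
    exact Finset.sum_congr rfl fun S _ => (hf S k hk).2.2

end Decomposition

section LatticePolytope

variable {n : ℕ}

/-- The lift of an integral point to height one. -/
def liftPoint (v : Fin n → ℤ) : (Fin n → ℝ) × ℝ := (fun i => (v i : ℝ), 1)

/-- The inclusion of the graded integral lattice. -/
def latticeEmbedding (n : ℕ) : (Fin n → ℤ) × ℤ →+ (Fin n → ℝ) × ℝ where
  toFun x := (fun i => (x.1 i : ℝ), (x.2 : ℝ))
  map_zero' := by ext <;> simp
  map_add' x y := by ext <;> simp

theorem finite_preimage_latticeEmbedding {B : Set ((Fin n → ℝ) × ℝ)}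
    (hB : Bornology.IsBounded B) : (latticeEmbedding n ⁻¹' B).Finite := by
  obtain ⟨R, hR⟩ := hB.exists_norm_le
  let N : ℤ := ⌈R⌉
  refine ((Set.finite_Icc (fun _ : Fin n => -N) fun _ => N).prod (Set.finite_Icc (-N) N)).subset
    fun x hx => ?_
  have hnorm := hR _ hx
  have bound (m : ℤ) (hm : ‖(m : ℝ)‖ ≤ R) : -N ≤ m ∧ m ≤ N := by
    rw [Real.norm_eq_abs] at hm
    have : ((|m| : ℤ) : ℝ) ≤ (N : ℝ) := by
      push_cast
      exact hm.trans (Int.le_ceil R)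
    exact abs_le.1 (by exact_mod_cast this)
  have h1 (i : Fin n) : -N ≤ x.1 i ∧ x.1 i ≤ N :=
    bound _ ((norm_le_pi_norm (latticeEmbedding n x).1 i).trans ((norm_fst_le _).trans hnorm))
  have h2 : -N ≤ x.2 ∧ x.2 ≤ N := bound _ ((norm_snd_le (latticeEmbedding n x)).trans hnorm)
  exact ⟨⟨fun i => (h1 i).1, fun i => (h1 i).2⟩, h2⟩

variable {V : Finset (Fin n → ℤ)} {Q : Set (Fin n → ℝ)}

theorem mem_posCone_liftPoint_iff
    (hQ : Q = convexHull ℝ ((fun v : Fin n → ℤ => fun i => (v i : ℝ)) '' ↑V))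
    {y : Fin n → ℝ} {t : ℝ} (ht : 0 < t) :
    (y, t) ∈ posCone (fun v : V => liftPoint v.1) ↔ y ∈ t • Q := by
  rw [Set.mem_smul_set_iff_inv_smul_mem₀ ht.ne']
  constructor
  · rintro ⟨a, ha, hay⟩
    have h1 : ∑ v : V, a v • (fun i => ((v : Fin n → ℤ) i : ℝ)) = y := by
      simpa [liftPoint, Prod.fst_sum] using congrArg Prod.fst hay
    have h2 : ∑ v : V, a v = t := by
      simpa [liftPoint, Prod.snd_sum] using congrArg Prod.snd hay
    rw [← h1, Finset.smul_sum, hQ]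
    simp only [smul_smul]
    refine (convex_convexHull ℝ _).sum_mem
      (fun v _ => mul_nonneg (inv_nonneg.2 ht.le) (ha v)) ?_
      fun v _ => subset_convexHull ℝ _ ⟨v, v.2, rfl⟩
    rw [← Finset.mul_sum, h2, inv_mul_cancel₀ ht.ne']
  · intro hy
    have hsub : Q ⊆ {z | (z, (1 : ℝ)) ∈ posCone (fun v : V => liftPoint v.1)} := by
      rw [hQ]
      refine convexHull_min ?_ ?_
      · rintro _ ⟨v, hv, rfl⟩
        classical
        refine ⟨Pi.single ⟨v, hv⟩ 1, fun i => ?_, by simp [liftPoint, Pi.single_apply]⟩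
        by_cases hi : i = ⟨v, hv⟩ <;> simp [hi]
      · intro z hz z' hz' a b ha hb hab
        have := posCone_add_mem (posCone_smul_mem hz ha) (posCone_smul_mem hz' hb)
        simpa [hab] using this
    have := posCone_smul_mem (hsub hy) ht.le
    simpa [smul_smul, mul_inv_cancel₀ ht.ne'] using this

theorem mem_interior_posCone_liftPoint_iff
    (hQ : Q = convexHull ℝ ((fun v : Fin n → ℤ => fun i => (v i : ℝ)) '' ↑V))
    {y : Fin n → ℝ} {t : ℝ} (ht : 0 < t) :
    (y, t) ∈ interior (posCone (fun v : V => liftPoint v.1)) ↔ y ∈ interior (t • Q) := by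
  constructor
  · intro h
    refine mem_interior.2 ⟨(fun z => (z, t)) ⁻¹' interior _, fun z hz => ?_,
      isOpen_interior.preimage (by fun_prop), h⟩
    exact (mem_posCone_liftPoint_iff hQ ht).1 (interior_subset hz)
  · intro h
    rw [mem_interior_iff_mem_nhds]
    have hcont : ContinuousAt (fun z : (Fin n → ℝ) × ℝ => (t / z.2) • z.1) (y, t) :=
      (continuousAt_const.div continuousAt_snd ht.ne').smul continuousAt_fst
    have h1 : ∀ᶠ z : (Fin n → ℝ) × ℝ in nhds (y, t), (t / z.2) • z.1 ∈ interior (t • Q) := by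
      refine hcont.eventually (isOpen_interior.mem_nhds ?_)
      simpa [div_self ht.ne'] using h
    have h2 : ∀ᶠ z : (Fin n → ℝ) × ℝ in nhds (y, t), 0 < z.2 :=
      continuousAt_snd.eventually (lt_mem_nhds ht)
    filter_upwards [h1, h2] with z hz hz2
    rw [← Prod.mk.eta (p := z), mem_posCone_liftPoint_iff hQ hz2,
      Set.mem_smul_set_iff_inv_smul_mem₀ hz2.ne']
    have h3 := (Set.mem_smul_set_iff_inv_smul_mem₀ ht.ne' _ _).1 (interior_subset hz)
    rw [smul_smul] at h3
    convert h3 using 2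
    field_simp

theorem ncard_latticeEmbedding_slice (C : Set ((Fin n → ℝ) × ℝ)) (k : ℕ) :
    {x | latticeEmbedding n x ∈ C ∧ AddMonoidHom.snd (Fin n → ℤ) ℤ x = k}.ncard =
      {x : Fin n → ℤ | ((fun i => (x i : ℝ)), (k : ℝ)) ∈ C}.ncard := by
  rw [← Set.ncard_image_of_injective {x : Fin n → ℤ | _} (Prod.mk_left_injective (k : ℤ))]
  refine congrArg Set.ncard (Set.ext fun ⟨x, m⟩ => ?_)
  constructor
  · rintro ⟨h, rfl : m = k⟩
    exact ⟨x, by simpa [latticeEmbedding] using h, rfl⟩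
  · rintro ⟨x', h, h'⟩
    obtain ⟨rfl, rfl⟩ := Prod.mk.inj h'
    exact ⟨by simpa [latticeEmbedding] using h, rfl⟩

end LatticePolytope

/-- Ehrhart reciprocity: for a full-dimensional lattice polytope `Q ⊆ ℝⁿ` with
Ehrhart polynomial `p`, the value `(-1)^n * p(-k)` equals the number of interior
lattice points of `kQ`, for every positive integer `k`. -/
theorem stmt_0 (n : ℕ) (V : Finset (Fin n → ℤ)) (Q : Set (Fin n → ℝ))
    (hQ : Q = convexHull ℝ ((fun v : Fin n → ℤ => fun i => (v i : ℝ)) '' ↑V))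
    (hfull : (interior Q).Nonempty)
    (p : Polynomial ℚ)
    (hp : ∀ k : ℕ, 0 < k →
      p.eval (k : ℚ) =
        ({x : Fin n → ℤ | (fun i => (x i : ℝ)) ∈ (k : ℝ) • Q}).ncard) :
    ∀ k : ℕ, 0 < k →
      (-1 : ℚ) ^ n * p.eval (-(k : ℚ)) =
        ({x : Fin n → ℤ | (fun i => (x i : ℝ)) ∈ interior ((k : ℝ) • Q)}).ncard := by
  obtain ⟨q, hq⟩ := hfull
  obtain ⟨f, hf⟩ := posCone_reciprocity (w := fun v : V => liftPoint v.1) (n := n)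
    (ht := LinearMap.snd ℝ (Fin n → ℝ) ℝ) (j := latticeEmbedding n)
    (htL := AddMonoidHom.snd (Fin n → ℤ) ℤ) (e := fun v => (v.1, 1))
    (by simp) (fun _ => rfl)
    ⟨(q, 1), (mem_interior_posCone_liftPoint_iff hQ one_pos).2 (by rwa [one_smul])⟩
    (fun _ => finite_preimage_latticeEmbedding) (fun _ => rfl)
    (fun _ => by simp [latticeEmbedding, liftPoint])
  have hpf : p = f := by
    refine Polynomial.eq_of_infinite_eval_eq p f
      ((Set.infinite_range_of_injective (f := fun k : ℕ => ((k + 1 : ℕ) : ℚ))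
        fun a b hab => by simpa using hab).mono ?_)
    rintro _ ⟨k, rfl⟩
    rw [Set.mem_ofPred_eq, hp _ k.succ_pos, (hf _ k.succ_pos).1, ncard_latticeEmbedding_slice]
    simp only [mem_posCone_liftPoint_iff hQ (Nat.cast_pos.2 k.succ_pos)]
  intro k hk
  rw [hpf, (hf k hk).2, ncard_latticeEmbedding_slice]
  simp only [mem_interior_posCone_liftPoint_iff hQ (Nat.cast_pos.2 hk)]
end

section
/- Let Q be a 3-dimensional polytope. If D_1, …, D_t is a partial shelling of the facets of Q (with t < s, s the total number of facets), then the union |D_I| = D_1 ∪ ⋯ ∪ D_t is homeomorphic to a closed 2-dimensional disk. -/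
open Set Metric Topology

theorem exists_continuousOn_leftInvOn {X Y : Type*} [TopologicalSpace X] [TopologicalSpace Y]
    [T2Space Y] [Nonempty X] {f : X → Y} {K : Set X} (hK : IsCompact K) (hf : ContinuousOn f K)
    (hi : InjOn f K) : ∃ g : Y → X, ContinuousOn g (f '' K) ∧ LeftInvOn g f K := by
  refine ⟨Function.invFunOn f K, ?_, hi.leftInvOn_invFunOn⟩
  rw [continuousOn_iff_isClosed]
  intro t ht
  refine ⟨f '' (K ∩ t), ((hK.inter_right ht).image_of_continuousOn
    (hf.mono inter_subset_left)).isClosed, ?_⟩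
  ext y
  constructor
  · rintro ⟨hy, x, hx, rfl⟩
    rw [mem_preimage, hi.leftInvOn_invFunOn hx] at hy
    exact ⟨⟨x, ⟨hx, hy⟩, rfl⟩, x, hx, rfl⟩
  · rintro ⟨⟨x, ⟨hx, hxt⟩, rfl⟩, hy⟩
    exact ⟨by rwa [mem_preimage, hi.leftInvOn_invFunOn hx], hy⟩

/-- `f` has a continuous logarithm on the set `K`. -/
def HasLogOn (f : ℂ → ℂ) (K : Set ℂ) : Prop :=
  ∃ g : ℂ → ℂ, ContinuousOn g K ∧ ∀ x ∈ K, Complex.exp (g x) = f x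

theorem HasLogOn.of_homotopy {K : Set ℂ} {H : ℝ × ℂ → ℂ}
    (hH : ContinuousOn H (Icc 0 1 ×ˢ K)) (hne : ∀ p ∈ Icc (0 : ℝ) 1 ×ˢ K, H p ≠ 0)
    (h0 : HasLogOn (fun x => H (0, x)) K) : HasLogOn (fun x => H (1, x)) K := by
  classical
  obtain ⟨g, hg, hgH⟩ := h0
  let i : unitInterval × K → ℝ × ℂ := fun p => (p.1, p.2)
  have hi : ∀ p, i p ∈ Icc (0 : ℝ) 1 ×ˢ K := fun p => ⟨p.1.2, p.2.2⟩
  let H' : C(unitInterval × K, {z : ℂ // z ≠ 0}) :=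
    ⟨fun p => ⟨H (i p), hne _ (hi p)⟩,
      (hH.comp_continuous (by fun_prop) hi).subtype_mk _⟩
  let g' : C(K, ℂ) := ⟨fun x => g x, continuousOn_iff_continuous_domRestrict.1 hg⟩
  have hz : ∀ x, H' (0, x) = ⟨_, Complex.exp_ne_zero (g' x)⟩ := fun x =>
    Subtype.ext (hgH x x.2).symm
  let G := Complex.isCoveringMap_exp.liftHomotopy H' g' hz
  have hG := Complex.isCoveringMap_exp.liftHomotopy_lifts H' g' hz
  refine ⟨fun x => if h : x ∈ K then G (1, ⟨x, h⟩) else 0, ?_, fun x hx => ?_⟩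
  · rw [continuousOn_iff_continuous_domRestrict]
    have : K.domRestrict (fun x => if h : x ∈ K then G (1, ⟨x, h⟩) else 0) =
        fun x : K => G (1, x) := by
      ext x; simp
    rw [this]; fun_prop
  · have := congrArg Subtype.val (congrFun hG (1, ⟨x, hx⟩))
    simp only [dif_pos hx]
    exact this

theorem HasLogOn.comp {f h : ℂ → ℂ} {K L : Set ℂ} (hf : HasLogOn f K)
    (hh : ContinuousOn h L) (hm : MapsTo h L K) : HasLogOn (fun x => f (h x)) L := by
  obtain ⟨g, hg, hgf⟩ := hf
  exact ⟨fun x => g (h x), hg.comp hh hm, fun x hx => hgf _ (hm hx)⟩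

theorem HasLogOn.mono {f : ℂ → ℂ} {K L : Set ℂ} (hf : HasLogOn f K) (h : L ⊆ K) :
    HasLogOn f L :=
  hf.comp continuousOn_id h

theorem hasLogOn_closedBall {f : ℂ → ℂ} (hf : ContinuousOn f (closedBall 0 1))
    (hne : ∀ x ∈ closedBall (0 : ℂ) 1, f x ≠ 0) : HasLogOn f (closedBall 0 1) := by
  have hm : ∀ p ∈ Icc (0 : ℝ) 1 ×ˢ closedBall (0 : ℂ) 1,
      (p.1 : ℂ) * p.2 ∈ closedBall (0 : ℂ) 1 := by
    rintro ⟨t, x⟩ ⟨⟨h0, h1⟩, hx⟩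
    simp only [mem_closedBall, dist_zero_right, norm_mul, Complex.norm_real, Real.norm_eq_abs,
      abs_of_nonneg h0] at hx ⊢
    exact mul_le_one₀ h1 (norm_nonneg _) hx
  have := HasLogOn.of_homotopy (K := closedBall 0 1) (H := fun p => f (p.1 * p.2))
    (hf.comp (by fun_prop) hm) (fun p hp => hne _ (hm p hp))
    ⟨fun _ => Complex.log (f 0), continuousOn_const, fun x _ => by
      simpa using Complex.exp_log (hne 0 (by simp))⟩
  simpa using this

theorem not_hasLogOn_sphere_of_odd {h : ℂ → ℂ} (hodd : ∀ x ∈ sphere (0 : ℂ) 1, h (-x) = -h x) :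
    ¬ HasLogOn h (sphere 0 1) := by
  rintro ⟨g, hg, hgh⟩
  have hneg : MapsTo (fun x : ℂ => -x) (sphere 0 1) (sphere 0 1) := fun x hx => by simpa using hx
  have hd : ContinuousOn (fun x => (g (-x) - g x).im) (sphere (0 : ℂ) 1) :=
    Complex.continuous_im.comp_continuousOn ((hg.comp (by fun_prop) hneg).sub hg)
  have hexp : ∀ x ∈ sphere (0 : ℂ) 1, Complex.exp (g (-x) - g x) = -1 := fun x hx => by
    have hne : h x ≠ 0 := by rw [← hgh x hx]; exact Complex.exp_ne_zero _
    rw [Complex.exp_sub, hgh _ (hneg hx), hgh x hx, hodd x hx, neg_div, div_self hne]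
  have hconn : IsPreconnected (sphere (0 : ℂ) 1) :=
    isPreconnected_sphere (by rw [Complex.rank_real_complex]; norm_num) 0 1
  have h1 : (1 : ℂ) ∈ sphere (0 : ℂ) 1 := by simp
  have h1' : (-1 : ℂ) ∈ sphere (0 : ℂ) 1 := by simp
  have hmem : (0 : ℝ) ∈ uIcc (g (-1) - g 1).im (g (- -1) - g (-1)).im := by
    have : (g (- -1) - g (-1)).im = -(g (-1) - g 1).im := by simp
    rw [this, mem_uIcc]
    rcases le_total 0 (g (-1) - g 1).im with h | h
    · right; constructor <;> linarith
    · left; constructor <;> linarith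
  have hpc := (hconn.image _ hd).ordConnected
  obtain ⟨x, hx, hx0⟩ := hpc.uIcc_subset (mem_image_of_mem _ h1) (mem_image_of_mem _ h1') hmem
  have := congrArg Complex.re (hexp x hx)
  simp only at hx0
  rw [Complex.exp_re, hx0] at this
  simp only [Real.cos_zero, mul_one, Complex.neg_re, Complex.one_re] at this
  linarith [Real.exp_pos (g (-x) - g x).re]

theorem not_hasLogOn_sphere_of_injOn {f : ℂ → ℂ} (hf : ContinuousOn f (closedBall 0 1))
    (hinj : InjOn f (closedBall 0 1)) :
    ¬ HasLogOn (fun x => f x - f 0) (sphere 0 1) := by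
  intro hlog
  have hm₁ : ∀ p ∈ Icc (0 : ℝ) 1 ×ˢ sphere (0 : ℂ) 1,
      (((1 + p.1)⁻¹ : ℝ) : ℂ) * p.2 ∈ closedBall (0 : ℂ) 1 := by
    rintro ⟨t, x⟩ ⟨⟨h0, h1⟩, hx⟩
    simp only [mem_closedBall, mem_sphere, dist_zero_right, norm_mul, Complex.norm_real,
      Real.norm_eq_abs] at hx h0 h1 ⊢
    rw [hx, abs_of_nonneg (by positivity), mul_one]
    exact inv_le_one_of_one_le₀ (by linarith)
  have hm₂ : ∀ p ∈ Icc (0 : ℝ) 1 ×ˢ sphere (0 : ℂ) 1,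
      ((-(p.1 * (1 + p.1)⁻¹) : ℝ) : ℂ) * p.2 ∈ closedBall (0 : ℂ) 1 := by
    rintro ⟨t, x⟩ ⟨⟨h0, h1⟩, hx⟩
    simp only [mem_closedBall, mem_sphere, dist_zero_right, norm_mul, Complex.norm_real,
      Real.norm_eq_abs] at hx h0 h1 ⊢
    rw [hx, abs_neg, abs_of_nonneg (by positivity), mul_one]
    exact mul_le_one₀ h1 (by positivity) (inv_le_one_of_one_le₀ (by linarith))
  have hc : ContinuousOn (fun p : ℝ × ℂ => (1 + p.1)⁻¹) (Icc (0 : ℝ) 1 ×ˢ sphere (0 : ℂ) 1) :=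
    ContinuousOn.inv₀ (by fun_prop) fun p hp => by have := hp.1.1; positivity
  have := HasLogOn.of_homotopy (K := sphere 0 1)
    (H := fun p => f (((1 + p.1)⁻¹ : ℝ) * p.2) - f ((-(p.1 * (1 + p.1)⁻¹) : ℝ) * p.2))
    ((hf.comp (by fun_prop) hm₁).sub (hf.comp (by fun_prop) hm₂))
    (fun p hp h => by
      have h0 := hp.1.1
      have := hinj (hm₁ p hp) (hm₂ p hp) (sub_eq_zero.1 h)
      have hx : p.2 ≠ 0 := by
        rintro hx; have := hp.2; simp [hx] at this
      have := Complex.ofReal_injective (mul_right_cancel₀ hx this)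
      have h2 : 0 < (1 + p.1)⁻¹ := by positivity
      nlinarith [mul_nonneg h0 h2.le])
    (by simpa using hlog)
  refine not_hasLogOn_sphere_of_odd (fun x _ => ?_) this
  have h2 : (((1 + 1 : ℝ)⁻¹ : ℝ) : ℂ) * -x = ((-(1 * (1 + 1)⁻¹) : ℝ) : ℂ) * x := by
    push_cast; ring
  have h3 : ((-(1 * (1 + 1)⁻¹) : ℝ) : ℂ) * -x = (((1 + 1 : ℝ)⁻¹ : ℝ) : ℂ) * x := by
    push_cast; ring
  simp only [h2, h3, neg_sub]

/-- If the boundary curve of a disc in the plane lies in another disc, so does its centre. -/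
theorem apply_zero_mem_of_image_sphere_subset {f g : ℂ → ℂ}
    (hf : ContinuousOn f (closedBall 0 1)) (hfi : InjOn f (closedBall 0 1))
    (hg : ContinuousOn g (closedBall 0 1)) (hgi : InjOn g (closedBall 0 1))
    (h : f '' sphere 0 1 ⊆ g '' closedBall 0 1) : f 0 ∈ g '' closedBall 0 1 := by
  by_contra h0
  obtain ⟨k, hk, hkg⟩ : ∃ k : ℂ → ℂ, ContinuousOn k (g '' closedBall 0 1) ∧
      ∀ x ∈ closedBall (0 : ℂ) 1, k (g x) = x := by
    simpa [LeftInvOn] using exists_continuousOn_leftInvOn (isCompact_closedBall 0 1) hg hgi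
  have h1 : HasLogOn (fun x => g x - f 0) (closedBall 0 1) :=
    hasLogOn_closedBall (hg.sub continuousOn_const) fun x hx he =>
      h0 ⟨x, hx, sub_eq_zero.1 he⟩
  have hm : MapsTo (fun x => k (f x)) (sphere 0 1) (closedBall 0 1) := fun x hx => by
    obtain ⟨y, hy, hyx⟩ := h (mem_image_of_mem f hx)
    simpa [← hyx, hkg y hy] using hy
  have h2 := h1.comp (hk.comp (hf.mono sphere_subset_closedBall)
    fun x hx => h (mem_image_of_mem f hx)) hm
  refine not_hasLogOn_sphere_of_injOn hf hfi ?_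
  obtain ⟨l, hl, hlf⟩ := h2
  refine ⟨l, hl, fun x hx => ?_⟩
  obtain ⟨y, hy, hyx⟩ := h (mem_image_of_mem f hx)
  rw [hlf x hx]
  simp [← hyx, hkg y hy]

theorem image_closedBall_mem_nhds_apply_zero {f : ℂ → ℂ} (hf : ContinuousOn f (closedBall 0 1))
    (hfi : InjOn f (closedBall 0 1)) : f '' closedBall 0 1 ∈ 𝓝 (f 0) := by
  have hK : IsCompact (f '' sphere 0 1) :=
    (isCompact_sphere 0 1).image_of_continuousOn (hf.mono sphere_subset_closedBall)
  have hn : f 0 ∉ f '' sphere 0 1 := by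
    rintro ⟨x, hx, hx0⟩
    have := hfi (sphere_subset_closedBall hx) (by simp) hx0
    simp [this] at hx
  obtain ⟨ε, hε, hball⟩ := Metric.isOpen_iff.1 hK.isClosed.isOpen_compl _ hn
  refine Filter.mem_of_superset (ball_mem_nhds _ hε) fun q hq => ?_
  by_contra hqn
  have hlog : HasLogOn (fun x => f x - q) (sphere 0 1) :=
    (hasLogOn_closedBall (hf.sub continuousOn_const) fun x hx he =>
      hqn ⟨x, hx, sub_eq_zero.1 he⟩).mono sphere_subset_closedBall
  refine not_hasLogOn_sphere_of_injOn hf hfi ?_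
  have hfs := hf.mono sphere_subset_closedBall
  have := HasLogOn.of_homotopy (K := sphere 0 1)
    (H := fun p => f p.2 - (q + p.1 * (f 0 - q)))
    ((hfs.comp continuousOn_snd fun p hp => hp.2).sub (by fun_prop))
    (fun p hp he => by
      refine hball ?_ (mem_image_of_mem f hp.2)
      rw [sub_eq_zero.1 he, mem_ball, dist_eq_norm]
      have : q + p.1 * (f 0 - q) - f 0 = ((1 - p.1 : ℝ) : ℂ) * (q - f 0) := by push_cast; ring
      rw [this, norm_mul, Complex.norm_real, Real.norm_eq_abs,
        abs_of_nonneg (by linarith [hp.1.2])]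
      rw [mem_ball, dist_eq_norm] at hq
      nlinarith [norm_nonneg (q - f 0), hp.1.1])
    (by simpa using hlog)
  simpa using this

/-- Invariance of domain for discs in the plane. -/
theorem image_closedBall_mem_nhds {f : ℂ → ℂ} (hf : ContinuousOn f (closedBall 0 1))
    (hfi : InjOn f (closedBall 0 1)) {z : ℂ} (hz : z ∈ ball (0 : ℂ) 1) :
    f '' closedBall 0 1 ∈ 𝓝 (f z) := by
  have hr : 0 < 1 - ‖z‖ := by simpa using hz
  have hm : MapsTo (fun x : ℂ => z + ((1 - ‖z‖ : ℝ) : ℂ) * x) (closedBall 0 1)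
      (closedBall 0 1) := fun x hx => by
    simp only [mem_closedBall, dist_zero_right] at hx ⊢
    refine (norm_add_le _ _).trans ?_
    rw [norm_mul, Complex.norm_real, Real.norm_eq_abs, abs_of_pos hr]
    nlinarith
  have := image_closedBall_mem_nhds_apply_zero (hf.comp (by fun_prop) hm)
    (hfi.comp (fun x _ y _ h => by
      exact mul_left_cancel₀ (Complex.ofReal_ne_zero.2 hr.ne') (add_left_cancel h)) hm)
  simp only [Function.comp_apply, mul_zero, add_zero] at this
  refine Filter.mem_of_superset this ?_
  rintro _ ⟨x, hx, rfl⟩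
  exact ⟨_, hm hx, rfl⟩
/-- A nondegenerate proper subarc of the unit circle is cut out by a half-plane. -/
theorem exists_eq_setOf_le_re_of_isConnected {a : Set ℂ} (ha : a ⊆ sphere 0 1)
    (hcomp : IsCompact a) (hconn : IsConnected a) (hnt : a.Nontrivial) (hne : a ≠ sphere 0 1) :
    ∃ w : ℂ, ‖w‖ = 1 ∧ ∃ c ∈ Ioo (-1 : ℝ) 1,
      ∀ z ∈ sphere (0 : ℂ) 1, z ∈ a ↔ c ≤ (w * z).re := by
  obtain ⟨p, hp, hpa⟩ : ∃ p ∈ sphere (0 : ℂ) 1, p ∉ a := by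
    by_contra! h
    exact hne (ha.antisymm h)
  have hpn : ‖p‖ = 1 := by simpa using hp
  have hp0 : p ≠ 0 := by rintro rfl; simp at hpn
  have hnorm : ∀ z ∈ a, ‖-p⁻¹ * z‖ = 1 := fun z hz => by
    have : ‖z‖ = 1 := by simpa using ha hz
    simp [hpn, this]
  have hexp : ∀ z ∈ a, Complex.exp ((-p⁻¹ * z).arg * Complex.I) = -p⁻¹ * z := fun z hz => by
    have := Complex.norm_mul_exp_arg_mul_I (-p⁻¹ * z)
    rwa [hnorm z hz, Complex.ofReal_one, one_mul] at this
  have harg : ∀ z ∈ a, (-p⁻¹ * z).arg ≠ Real.pi := fun z hz h => by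
    have := hexp z hz
    rw [h, Complex.exp_pi_mul_I] at this
    have : z = p := by
      field_simp at this
      exact (neg_injective this).symm
    exact hpa (this ▸ hz)
  have hcont : ContinuousOn (fun z => (-p⁻¹ * z).arg) a := fun z hz => by
    refine ContinuousAt.continuousWithinAt (ContinuousAt.comp (Complex.continuousAt_arg ?_)
      (by fun_prop))
    rw [Complex.mem_slitPlane_iff_arg]
    exact ⟨harg z hz, fun h => by simpa [h] using hnorm z hz⟩
  obtain ⟨α, β, himg⟩ : ∃ α β, (fun z => (-p⁻¹ * z).arg) '' a = Icc α β :=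
    ⟨_, _, eq_Icc_of_connected_compact (hconn.image _ hcont) (hcomp.image_of_continuousOn hcont)⟩
  have hinj : InjOn (fun z => (-p⁻¹ * z).arg) a := fun x hx y hy h => by
    have h1 := hexp x hx
    simp only at h
    rw [h, hexp y hy] at h1
    exact (mul_left_cancel₀ (by simpa using hp0) h1).symm
  obtain ⟨x, hx, y, hy, hxy⟩ := hnt
  have hαβ : α < β := by
    have h1 : (-p⁻¹ * x).arg ∈ Icc α β := himg ▸ mem_image_of_mem _ hx
    have h2 : (-p⁻¹ * y).arg ∈ Icc α β := himg ▸ mem_image_of_mem _ hy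
    by_contra! h
    exact hxy (hinj hx hy (by simp only; linarith [h1.1, h1.2, h2.1, h2.2]))
  have hα : -Real.pi < α := by
    obtain ⟨z, -, hz⟩ : α ∈ (fun z => (-p⁻¹ * z).arg) '' a := himg ▸ left_mem_Icc.2 hαβ.le
    exact hz ▸ Complex.neg_pi_lt_arg _
  have hβ : β < Real.pi := by
    obtain ⟨z, hza, hz⟩ : β ∈ (fun z => (-p⁻¹ * z).arg) '' a := himg ▸ right_mem_Icc.2 hαβ.le
    exact hz ▸ lt_of_le_of_ne (Complex.arg_le_pi _) (harg z hza)
  set m := (α + β) / 2 with hm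
  set δ := (β - α) / 2 with hδ
  have hcos : ∀ θ : ℝ, |θ| ≤ Real.pi → (Real.cos δ ≤ Real.cos θ ↔ |θ| ≤ δ) := fun θ hθ => by
    rw [← Real.cos_abs θ]
    exact Real.strictAntiOn_cos.le_iff_ge ⟨by linarith, by linarith⟩ ⟨abs_nonneg _, hθ⟩
  have hm1 : ‖Complex.exp (-m * Complex.I)‖ = 1 := by
    exact_mod_cast Complex.norm_exp_ofReal_mul_I (-m)
  refine ⟨-p⁻¹ * Complex.exp (-m * Complex.I), ?_, Real.cos δ, ⟨?_, ?_⟩, fun z hz => ⟨?_, ?_⟩⟩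
  · rw [norm_mul, hm1, norm_neg, norm_inv, hpn]; norm_num
  · rw [← Real.cos_pi]
    exact Real.strictAntiOn_cos ⟨by linarith, by linarith⟩ ⟨Real.pi_pos.le, le_rfl⟩ (by linarith)
  · rw [← Real.cos_zero]
    exact Real.strictAntiOn_cos ⟨le_rfl, Real.pi_pos.le⟩ ⟨by linarith, by linarith⟩ (by linarith)
  · intro hza
    have h1 : (-p⁻¹ * z).arg ∈ Icc α β := himg ▸ mem_image_of_mem _ hza
    have : -p⁻¹ * Complex.exp (-m * Complex.I) * z =
        Complex.exp (((-p⁻¹ * z).arg - m : ℝ) * Complex.I) := by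
      rw [mul_right_comm, ← hexp z hza, ← Complex.exp_add, hexp z hza]
      congr 1; push_cast; ring
    have h2 : |(-p⁻¹ * z).arg - m| ≤ δ := abs_le.2 ⟨by linarith [h1.1], by linarith [h1.2]⟩
    rw [this, Complex.exp_ofReal_mul_I_re, hcos _ (by linarith)]
    exact h2
  · intro hc
    set ζ := -p⁻¹ * Complex.exp (-m * Complex.I) * z with hζ
    have hz1 : ‖z‖ = 1 := by simpa using hz
    have hζn : ‖ζ‖ = 1 := by
      rw [hζ, norm_mul, norm_mul, hm1, norm_neg, norm_inv, hpn, hz1]; norm_num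
    have hζe : Complex.exp (ζ.arg * Complex.I) = ζ := by
      simpa [hζn] using Complex.norm_mul_exp_arg_mul_I ζ
    rw [← hζe, Complex.exp_ofReal_mul_I_re, hcos _ (Complex.abs_arg_le_pi _)] at hc
    have h3 : m + ζ.arg ∈ Icc α β := by
      constructor <;> linarith [(abs_le.1 hc).1, (abs_le.1 hc).2]
    rw [← himg] at h3
    obtain ⟨z', hz', he⟩ := h3
    have : -p⁻¹ * z' = -p⁻¹ * z := by
      simp only at he
      rw [← hexp z' hz', he]
      push_cast
      rw [add_mul, Complex.exp_add, hζe, hζ]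
      have : Complex.exp (m * Complex.I) * Complex.exp (-m * Complex.I) = 1 := by
        rw [← Complex.exp_add]; simp
      linear_combination (-p⁻¹ * z) * this
    exact mul_left_cancel₀ (by simpa using hp0) this ▸ hz'

theorem exists_homeomorph_image_closedBall_eq_reProdIm {c : ℝ} (hc : c ∈ Ioo (-1 : ℝ) 1) :
    ∃ p q : ℝ, 0 < p ∧ 0 < q ∧ ∃ e : ℂ ≃ₜ ℂ,
      e '' closedBall 0 1 = Icc (-p) p ×ℂ Icc (-q) q ∧
      ∀ z ∈ closedBall (0 : ℂ) 1, (e z).re = p ↔ z ∈ sphere 0 1 ∧ c ≤ z.re := by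
  obtain ⟨hc1, hc2⟩ := hc
  set r : ℝ := (c - 1) / 2 with hr
  have hq2 : 0 < 1 - c ^ 2 := by nlinarith
  obtain ⟨p, hp⟩ : ∃ p, p = c - r := ⟨_, rfl⟩
  obtain ⟨q, hq⟩ : ∃ q, q = Real.sqrt (1 - c ^ 2) := ⟨_, rfl⟩
  have hp0 : 0 < p := by linarith
  have hq0 : 0 < q := by rw [hq]; positivity
  have hqq : q ^ 2 = 1 - c ^ 2 := by rw [hq, Real.sq_sqrt hq2.le]
  let B : Set ℂ := closedBall (-(r : ℂ)) 1
  let T : Set ℂ := Icc (-p) p ×ℂ Icc (-q) q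
  have hTi : interior T = Ioo (-p) p ×ℂ Ioo (-q) q := by
    rw [Complex.interior_reProdIm, interior_Icc, interior_Icc]
  have hBc : Convex ℝ B := convex_closedBall _ _
  have hB0 : B ∈ 𝓝 0 := closedBall_mem_nhds_of_mem (by
    simp only [mem_ball, dist_eq_norm, zero_sub, neg_neg, Complex.norm_real, Real.norm_eq_abs]
    rw [abs_lt]; constructor <;> linarith)
  have hBb : Bornology.IsVonNBounded ℝ B :=
    NormedSpace.isVonNBounded_iff ℝ |>.2 isBounded_closedBall
  have hTc : Convex ℝ T := ((convex_Icc (-p) p).linear_preimage Complex.reLm).inter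
    ((convex_Icc (-q) q).linear_preimage Complex.imLm)
  have hT0 : T ∈ 𝓝 0 := mem_interior_iff_mem_nhds.1 (by
    rw [hTi, Complex.mem_reProdIm]; simp [hp0, hq0])
  have hTcomp : IsCompact T := isCompact_Icc.reProdIm isCompact_Icc
  have hTb : Bornology.IsVonNBounded ℝ T :=
    NormedSpace.isVonNBounded_iff ℝ |>.2 hTcomp.isBounded
  let G := gaugeRescaleHomeomorph B T hBc hB0 hBb hTc hT0 hTb
  have hGcl : G '' B = T := by
    have := image_gaugeRescaleHomeomorph_closure hBc hB0 hBb hTc hT0 hTb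
    rwa [isClosed_closedBall.closure_eq, hTcomp.isClosed.closure_eq] at this
  have hGint : G '' interior B = interior T :=
    image_gaugeRescaleHomeomorph_interior hBc hB0 hBb hTc hT0 hTb
  have hintB : interior B = ball (-(r : ℂ)) 1 := interior_closedBall _ one_ne_zero
  have hGray : ∀ x, x ≠ 0 → ∃ l : ℝ, 0 < l ∧ G x = l • x := fun x hx =>
    ⟨gauge B x / gauge T x, div_pos ((gauge_pos (absorbent_nhds_zero hB0) hBb).2 hx)
      ((gauge_pos (absorbent_nhds_zero hT0) hTb).2 hx), rfl⟩
  have hmem : ∀ z : ℂ, z - r ∈ B ↔ z ∈ closedBall (0 : ℂ) 1 := fun z => by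
    simp [B, dist_eq_norm]
  have hmemi : ∀ z : ℂ, z - r ∈ interior B ↔ z ∈ ball (0 : ℂ) 1 := fun z => by
    simp [hintB, dist_eq_norm]
  refine ⟨p, q, hp0, hq0, (Homeomorph.subRight (r : ℂ)).trans G, ?_, fun z hz => ?_⟩
  · show (fun z => G (z - r)) '' _ = T
    rw [← image_image G (fun z => z - (r : ℂ)), ← hGcl]
    congr 1
    ext x
    constructor
    · rintro ⟨y, hy, rfl⟩; exact (hmem y).2 hy
    · intro hx; exact ⟨x + r, by rw [← hmem]; simpa using hx, by simp⟩
  · show (G (z - r)).re = p ↔ _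
    have hzT : G (z - r) ∈ T := hGcl ▸ mem_image_of_mem G ((hmem z).2 hz)
    have hzTi : G (z - r) ∈ interior T ↔ z ∈ ball (0 : ℂ) 1 := by
      rw [← hGint, G.injective.mem_set_image, hmemi]
    rw [hTi, Complex.mem_reProdIm] at hzTi
    rw [Complex.mem_reProdIm] at hzT
    obtain ⟨⟨hx1, hx2⟩, hy1, hy2⟩ := hzT
    by_cases hzS : z ∈ sphere (0 : ℂ) 1
    swap
    · have hzb : z ∈ ball (0 : ℂ) 1 := by
        simp only [mem_closedBall, mem_sphere, mem_ball] at *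
        exact lt_of_le_of_ne hz hzS
      have := (hzTi.2 hzb).1.2
      exact iff_of_false this.ne fun h => hzS h.1
    simp only [hzS, true_and]
    have hzn : z.re ^ 2 + z.im ^ 2 = 1 := by
      have : ‖z‖ = 1 := by simpa using hzS
      rw [← Complex.normSq_eq_norm_sq z |>.trans (by rw [this]; norm_num : ‖z‖ ^ 2 = 1),
        Complex.normSq_apply]; ring
    have hzr : z - r ≠ 0 := by
      intro h
      have : z = r := sub_eq_zero.1 h
      rw [this] at hzn; simp only [Complex.ofReal_re, Complex.ofReal_im] at hzn; nlinarith
    obtain ⟨l, hl, hGl⟩ := hGray _ hzr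
    have hre : (G (z - r)).re = l * (z.re - r) := by rw [hGl]; simp
    have him : (G (z - r)).im = l * z.im := by rw [hGl]; simp
    have hnot : ¬ ((G (z - r)).re ∈ Ioo (-p) p ∧ (G (z - r)).im ∈ Ioo (-q) q) := by
      rw [hzTi]; simp at hzS ⊢; exact hzS.ge
    rw [hre, him] at hnot
    rw [him] at hy1 hy2
    rw [hre] at hx2 ⊢
    constructor
    · intro h
      by_contra! hlt
      -- the point would lie strictly inside the triangle spanned by the chord and the centre
      have hX0 : 0 < z.re - r := by
        by_contra! h0; nlinarith
      have hXp : z.re - r < p := by linarith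
      have hY : (z.im * p) ^ 2 ≤ (q * (z.re - r)) ^ 2 := by
        have h1 : (l * z.im) ^ 2 ≤ q ^ 2 := sq_le_sq' hy1 hy2
        have h2 : l ^ 2 * (z.im * p) ^ 2 ≤ l ^ 2 * (q * (z.re - r)) ^ 2 := by
          have : l ^ 2 * (q * (z.re - r)) ^ 2 = q ^ 2 * (l * (z.re - r)) ^ 2 := by ring
          rw [this, h]
          nlinarith [sq_nonneg p]
        exact le_of_mul_le_mul_left h2 (by positivity)
      set s := (z.re - r) / p with hs
      have hs0 : 0 < s := by positivity
      have hs1 : s < 1 := (div_lt_one hp0).2 hXp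
      have hsx : z.re = r + s * (c - r) := by
        rw [← hp, hs]; field_simp; ring
      have hsy : z.im ^ 2 ≤ s ^ 2 * (1 - c ^ 2) := by
        rw [← hqq, hs, div_pow, div_mul_eq_mul_div, le_div_iff₀ (by positivity)]
        nlinarith
      have hr1 : r ^ 2 < 1 := by nlinarith
      have : (r + s * (c - r)) ^ 2 + s ^ 2 * (1 - c ^ 2) < 1 := by
        have h1 : r * c < 1 := by nlinarith [sq_nonneg (r - c)]
        have : 1 - ((r + s * (c - r)) ^ 2 + s ^ 2 * (1 - c ^ 2)) =
          (1 - s) * ((1 - s) * (1 - r ^ 2) + 2 * s * (1 - r * c)) := by ring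
        have h2 : 0 < (1 - s) * ((1 - s) * (1 - r ^ 2) + 2 * s * (1 - r * c)) := by
          have := sub_pos.2 hs1
          have := sub_pos.2 hr1
          have := sub_pos.2 h1
          positivity
        linarith
      rw [hsx] at hzn
      linarith
    · intro hcz
      by_contra hne
      have hlt : l * (z.re - r) < p := lt_of_le_of_ne hx2 hne
      have hX : p ≤ z.re - r := by linarith
      have hX0 : 0 < z.re - r := hp0.trans_le hX
      set s := p / (z.re - r) with hs
      have hs0 : 0 < s := by positivity
      have hs1 : s ≤ 1 := (div_le_one hX0).2 hX
      have hsx : (1 - s) * r + s * z.re = c := by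
        have : s * (z.re - r) = p := div_mul_cancel₀ _ hX0.ne'
        linear_combination this + hp
      have hY : s ^ 2 * z.im ^ 2 ≤ q ^ 2 := by
        have h1 : r * z.re ≤ 1 := by nlinarith [sq_nonneg (r - z.re), sq_nonneg z.im]
        have h2 : 1 - (((1 - s) * r + s * z.re) ^ 2 + s ^ 2 * z.im ^ 2) =
            (1 - s) * ((1 - s) * (1 - r ^ 2) + 2 * s * (1 - r * z.re)) := by
          linear_combination (-s ^ 2) * hzn
        have h3 : 0 ≤ (1 - s) * ((1 - s) * (1 - r ^ 2) + 2 * s * (1 - r * z.re)) := by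
          have := sub_nonneg.2 hs1
          have := sub_nonneg.2 h1
          have : 0 ≤ 1 - r ^ 2 := by nlinarith
          positivity
        rw [hsx] at h2
        linarith
      have hls : l < s := by rwa [hs, lt_div_iff₀ hX0]
      have hlX := mul_pos hl hX0
      refine hnot ⟨⟨by linarith, hlt⟩, abs_lt.1 (abs_lt_of_sq_lt_sq ?_ hq0.le)⟩
      rcases eq_or_ne z.im 0 with h0 | h0
      · rw [h0, mul_zero, zero_pow two_ne_zero]; positivity
      have h3 : 0 < z.im ^ 2 := by positivity
      have h1 : l ^ 2 < s ^ 2 := pow_lt_pow_left₀ hls hl.le two_ne_zero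
      rw [mul_pow]
      exact (mul_lt_mul_of_pos_right h1 h3).trans_le hY
theorem exists_square_param {f : ℂ → ℂ} (hf : ContinuousOn f (closedBall 0 1))
    (hfi : InjOn f (closedBall 0 1)) {a : Set ℂ} (ha : a ⊆ sphere 0 1)
    (hcomp : IsCompact a) (hconn : IsConnected a) (hnt : a.Nontrivial) (hne : a ≠ sphere 0 1) :
    ∃ u : ℂ → ℂ, ContinuousOn u (Icc 0 1 ×ℂ Icc 0 1) ∧ InjOn u (Icc 0 1 ×ℂ Icc 0 1) ∧
      u '' (Icc 0 1 ×ℂ Icc 0 1) = f '' closedBall 0 1 ∧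
      ∀ z ∈ Icc (0 : ℝ) 1 ×ℂ Icc (0 : ℝ) 1, u z ∈ f '' a ↔ z.re = 0 := by
  obtain ⟨w, hw, c, hc, hac⟩ := exists_eq_setOf_le_re_of_isConnected ha hcomp hconn hnt hne
  obtain ⟨p, q, hp, hq, e, he, hep⟩ := exists_homeomorph_image_closedBall_eq_reProdIm hc
  have hw0 : w ≠ 0 := by rintro rfl; simp at hw
  let S : ℂ → ℂ := fun z => ⟨p - 2 * p * z.re, -q + 2 * q * z.im⟩
  have hSc : Continuous S := by
    have : S = fun z => ((p - 2 * p * z.re : ℝ) : ℂ) + ((-q + 2 * q * z.im : ℝ) : ℂ) * Complex.I :=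
      funext fun z => Complex.mk_eq_add_mul_I _ _
    rw [this]
    fun_prop
  have hST : ∀ z ∈ Icc (0 : ℝ) 1 ×ℂ Icc (0 : ℝ) 1, S z ∈ e '' closedBall 0 1 := by
    rintro z ⟨⟨hx0, hx1⟩, hy0, hy1⟩
    rw [he]
    refine ⟨⟨?_, ?_⟩, ?_, ?_⟩ <;> simp only [S] <;> nlinarith
  have hSi : Function.Injective S := fun z z' h => by
    have h1 := congrArg Complex.re h
    have h2 := congrArg Complex.im h
    simp only [S] at h1 h2
    refine Complex.ext (mul_left_cancel₀ hp.ne' ?_) (mul_left_cancel₀ hq.ne' ?_) <;> linarith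
  have heD : ∀ z ∈ Icc (0 : ℝ) 1 ×ℂ Icc (0 : ℝ) 1, e.symm (S z) ∈ closedBall (0 : ℂ) 1 :=
    fun z hz => by
      obtain ⟨x, hx, hxz⟩ := hST z hz
      rwa [← hxz, e.symm_apply_apply]
  have hnorm : ∀ y, ‖w⁻¹ * y‖ = ‖y‖ := fun y => by rw [norm_mul, norm_inv, hw]; simp
  have hD : ∀ y, w⁻¹ * y ∈ closedBall (0 : ℂ) 1 ↔ y ∈ closedBall (0 : ℂ) 1 := fun y => by
    rw [mem_closedBall, mem_closedBall, dist_zero_right, dist_zero_right, hnorm]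
  have hS : ∀ y, w⁻¹ * y ∈ sphere (0 : ℂ) 1 ↔ y ∈ sphere (0 : ℂ) 1 := fun y => by
    rw [mem_sphere, mem_sphere, dist_zero_right, dist_zero_right, hnorm]
  have hm : MapsTo (fun z => w⁻¹ * e.symm (S z)) (Icc (0 : ℝ) 1 ×ℂ Icc (0 : ℝ) 1)
      (closedBall 0 1) := fun z hz => (hD _).2 (heD z hz)
  refine ⟨fun z => f (w⁻¹ * e.symm (S z)), hf.comp (by fun_prop) hm, ?_, ?_, fun z hz => ?_⟩
  · refine hfi.comp (Function.Injective.injOn fun z z' h => ?_) hm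
    exact hSi (e.symm.injective (mul_left_cancel₀ (inv_ne_zero hw0) h))
  · refine Subset.antisymm ?_ ?_
    · rintro _ ⟨z, hz, rfl⟩
      exact mem_image_of_mem f (hm hz)
    · rintro _ ⟨x, hx, rfl⟩
      have hwx : w * x ∈ closedBall (0 : ℂ) 1 := by
        rw [← hD, inv_mul_cancel_left₀ hw0]; exact hx
      have hT : e (w * x) ∈ Icc (-p) p ×ℂ Icc (-q) q := he ▸ mem_image_of_mem e hwx
      obtain ⟨⟨hx0, hx1⟩, hy0, hy1⟩ := hT
      refine ⟨⟨(p - (e (w * x)).re) / (2 * p), ((e (w * x)).im + q) / (2 * q)⟩,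
        ⟨⟨?_, ?_⟩, ?_, ?_⟩, ?_⟩
      · exact div_nonneg (by linarith) (by linarith)
      · exact div_le_one_of_le₀ (by linarith) (by linarith)
      · exact div_nonneg (by linarith) (by linarith)
      · exact div_le_one_of_le₀ (by linarith) (by linarith)
      · have : S ⟨(p - (e (w * x)).re) / (2 * p), ((e (w * x)).im + q) / (2 * q)⟩ =
            e (w * x) := by
          apply Complex.ext <;> simp only [S] <;> field_simp <;> ring
        simp only [this, e.symm_apply_apply, inv_mul_cancel_left₀ hw0]
  · rw [hfi.mem_image_iff (ha.trans sphere_subset_closedBall) (hm hz)]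
    have h1 := hep _ (heD z hz)
    rw [e.apply_symm_apply] at h1
    have h2 : w⁻¹ * e.symm (S z) ∈ a ↔
        e.symm (S z) ∈ sphere (0 : ℂ) 1 ∧ c ≤ (e.symm (S z)).re := by
      rw [← hS]
      constructor
      · intro h
        refine ⟨ha h, ?_⟩
        have := (hac _ (ha h)).1 h
        rwa [mul_inv_cancel_left₀ hw0] at this
      · rintro ⟨h, h'⟩
        refine (hac _ h).2 ?_
        rwa [mul_inv_cancel_left₀ hw0]
    rw [h2, ← h1]
    simp only [S]
    constructor
    · intro h
      exact mul_left_cancel₀ hp.ne' (by linarith)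
    · intro h
      rw [h]; ring

/-- Two squares glued along a common side form a rectangle. -/
theorem exists_rectangle_param {u v : ℂ → ℂ} {α : Set ℂ}
    (hu : ContinuousOn u (Icc 0 1 ×ℂ Icc 0 1)) (hui : InjOn u (Icc 0 1 ×ℂ Icc 0 1))
    (hv : ContinuousOn v (Icc 0 1 ×ℂ Icc 0 1)) (hvi : InjOn v (Icc 0 1 ×ℂ Icc 0 1))
    (huv : u '' (Icc 0 1 ×ℂ Icc 0 1) ∩ v '' (Icc 0 1 ×ℂ Icc 0 1) = α)
    (huα : ∀ z ∈ Icc (0 : ℝ) 1 ×ℂ Icc (0 : ℝ) 1, u z ∈ α ↔ z.re = 0)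
    (hvα : ∀ z ∈ Icc (0 : ℝ) 1 ×ℂ Icc (0 : ℝ) 1, v z ∈ α ↔ z.re = 0) :
    ∃ k : ℂ → ℂ, ContinuousOn k (Icc (-1) 1 ×ℂ Icc 0 1) ∧ InjOn k (Icc (-1) 1 ×ℂ Icc 0 1) ∧
      k '' (Icc (-1) 1 ×ℂ Icc 0 1) =
        u '' (Icc 0 1 ×ℂ Icc 0 1) ∪ v '' (Icc 0 1 ×ℂ Icc 0 1) := by
  obtain ⟨u', hu', hu'l⟩ :=
    exists_continuousOn_leftInvOn (isCompact_Icc.reProdIm isCompact_Icc) hu hui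
  have hside : ∀ y : ℝ, y ∈ Icc (0 : ℝ) 1 → (y * Complex.I) ∈ Icc (0 : ℝ) 1 ×ℂ Icc (0 : ℝ) 1 :=
    fun y hy => by rw [Complex.mem_reProdIm]; simpa using hy
  have hτ : ∀ y ∈ Icc (0 : ℝ) 1, ∃ x ∈ Icc (0 : ℝ) 1, u (x * Complex.I) = v (y * Complex.I) ∧
      u' (v (y * Complex.I)) = x * Complex.I := fun y hy => by
    have hvy : v (y * Complex.I) ∈ α := (hvα _ (hside y hy)).2 (by simp)
    obtain ⟨⟨z, hz, hzv⟩, -⟩ := huv.symm ▸ hvy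
    have hz0 : z.re = 0 := by rw [← huα z hz, hzv]; exact hvy
    have hzI : z = z.im * Complex.I := by apply Complex.ext <;> simp [hz0]
    refine ⟨z.im, hz.2, ?_, ?_⟩
    · rw [← hzI, hzv]
    · rw [← hzv, hu'l hz, ← hzI]
  let τ : ℝ → ℝ := fun y => (u' (v (y * Complex.I))).im
  have hτm : ∀ y ∈ Icc (0 : ℝ) 1, τ y ∈ Icc (0 : ℝ) 1 ∧ u (τ y * Complex.I) = v (y * Complex.I) :=
    fun y hy => by
      obtain ⟨x, hx, h1, h2⟩ := hτ y hy
      have : τ y = x := by simp [τ, h2]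
      rw [this]; exact ⟨hx, h1⟩
  have hτc : ContinuousOn τ (Icc 0 1) := by
    refine Complex.continuous_im.comp_continuousOn (hu'.comp
      (hv.comp (by fun_prop) hside) fun y hy => ?_)
    obtain ⟨x, hx, h1, -⟩ := hτ y hy
    exact ⟨_, hside x hx, h1⟩
  have hτi : InjOn τ (Icc 0 1) := fun y hy y' hy' h => by
    have h1 := (hτm y hy).2
    rw [h, (hτm y' hy').2] at h1
    have := hvi (hside _ hy') (hside _ hy) h1
    simpa using this.symm
  have hτs : ∀ x ∈ Icc (0 : ℝ) 1, ∃ y ∈ Icc (0 : ℝ) 1, τ y = x := fun x hx => by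
    have hux : u (x * Complex.I) ∈ α := (huα _ (hside x hx)).2 (by simp)
    obtain ⟨-, z, hz, hzu⟩ := huv.symm ▸ hux
    have hz0 : z.re = 0 := by rw [← hvα z hz, hzu]; exact hux
    have hzI : z = z.im * Complex.I := by apply Complex.ext <;> simp [hz0]
    refine ⟨z.im, hz.2, ?_⟩
    simp only [τ]
    rw [← hzI, hzu, hu'l (hside x hx)]; simp
  let R : ℂ → ℂ := fun z => ((-z.re : ℝ) : ℂ) + τ z.im * Complex.I
  have hR : ∀ z : ℂ, z.re ∈ Icc (-1 : ℝ) 0 → z.im ∈ Icc (0 : ℝ) 1 →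
      R z ∈ Icc (0 : ℝ) 1 ×ℂ Icc (0 : ℝ) 1 := fun z h1 h2 => by
    have hre : (R z).re = -z.re := by simp [R]
    have him : (R z).im = τ z.im := by simp [R]
    rw [Complex.mem_reProdIm, hre, him]
    exact ⟨⟨by linarith [h1.2], by linarith [h1.1]⟩, (hτm _ h2).1⟩
  have hk₁ : ContinuousOn (fun z : ℂ => u (R z)) (Icc (-1) 0 ×ℂ Icc 0 1) := by
    refine hu.comp ?_ fun z hz => hR z hz.1 hz.2
    have : ContinuousOn (fun z : ℂ => τ z.im) (Icc (-1) 0 ×ℂ Icc 0 1) :=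
      hτc.comp Complex.continuous_im.continuousOn fun z hz => hz.2
    simp only [R]
    fun_prop
  let k : ℂ → ℂ := fun z => if 0 ≤ z.re then v z else u (R z)
  have hkv : EqOn k v (Icc 0 1 ×ℂ Icc 0 1) := fun z hz => if_pos hz.1.1
  have hku : EqOn k (fun z => u (R z)) (Icc (-1) 0 ×ℂ Icc 0 1) := fun z hz => by
    rcases eq_or_lt_of_le hz.1.2 with h | h
    · have hz0 : z = z.im * Complex.I := by apply Complex.ext <;> simp [h]
      simp only [k, h, le_refl, if_true, R]
      rw [← show v (z.im * Complex.I) = v z by rw [← hz0], ← (hτm _ hz.2).2]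
      simp
    · exact if_neg h.not_ge
  have hsplit : Icc (-1 : ℝ) 1 ×ℂ Icc (0 : ℝ) 1 =
      (Icc (-1 : ℝ) 0 ×ℂ Icc (0 : ℝ) 1) ∪ (Icc (0 : ℝ) 1 ×ℂ Icc (0 : ℝ) 1) := by
    ext z
    have h : Icc (-1 : ℝ) 1 = Icc (-1) 0 ∪ Icc 0 1 :=
      (Icc_union_Icc_eq_Icc (by norm_num) (by norm_num)).symm
    rw [mem_union, Complex.mem_reProdIm, Complex.mem_reProdIm, Complex.mem_reProdIm, h,
      mem_union, or_and_right]
  refine ⟨k, ?_, ?_, ?_⟩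
  · rw [hsplit]
    exact (hk₁.congr hku).union_of_isClosed (hv.congr hkv)
      (isCompact_Icc.reProdIm isCompact_Icc).isClosed
      (isCompact_Icc.reProdIm isCompact_Icc).isClosed
  · have hmix : ∀ z ∈ Icc (-1 : ℝ) 0 ×ℂ Icc (0 : ℝ) 1, ∀ z' ∈ Icc (0 : ℝ) 1 ×ℂ Icc (0 : ℝ) 1,
        k z = k z' → z = z' := fun z hz z' hz' h => by
      have h' := h
      rw [hku hz, hkv hz'] at h'
      have hα : v z' ∈ α := huv ▸ ⟨⟨_, hR z hz.1 hz.2, h'⟩, z', hz', rfl⟩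
      have hz0 : z.re = 0 := by
        have := (huα _ (hR z hz.1 hz.2)).1 (by rw [← h'] at hα; exact hα)
        simpa [R] using this
      have hzM : z ∈ Icc (0 : ℝ) 1 ×ℂ Icc (0 : ℝ) 1 := ⟨by simp [hz0], hz.2⟩
      rw [hkv hzM, hkv hz'] at h
      exact hvi hzM hz' h
    rw [hsplit]
    rintro z (hz | hz) z' (hz' | hz') h
    · rw [hku hz, hku hz'] at h
      have := hui (hR z hz.1 hz.2) (hR z' hz'.1 hz'.2) h
      have h1 := congrArg Complex.re this
      have h2 := congrArg Complex.im this
      simp only [R, Complex.add_re, Complex.add_im, Complex.ofReal_re, Complex.ofReal_im,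
        Complex.re_ofReal_mul, Complex.im_ofReal_mul, Complex.I_re, Complex.I_im, mul_zero,
        mul_one, add_zero, zero_add, neg_inj] at h1 h2
      exact Complex.ext h1 (hτi hz.2 hz'.2 h2)
    · exact hmix z hz z' hz' h
    · exact (hmix z' hz' z hz h.symm).symm
    · rw [hkv hz, hkv hz'] at h
      exact hvi hz hz' h
  · rw [hsplit, image_union, hkv.image_eq, hku.image_eq]
    congr 1
    refine Subset.antisymm ?_ ?_
    · rintro _ ⟨z, hz, rfl⟩
      exact mem_image_of_mem u (hR z hz.1 hz.2)
    · rintro _ ⟨z, hz, rfl⟩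
      obtain ⟨y, hy, hyz⟩ := hτs z.im hz.2
      refine ⟨⟨-z.re, y⟩, ⟨⟨?_, ?_⟩, hy⟩, ?_⟩
      · simpa using hz.1.2
      · simpa using hz.1.1
      · simp [R, hyz]

/-- A convex body in the plane is a disc whose boundary circle is the frontier. -/
theorem exists_disc_param_of_convex {K : Set ℂ} (hK : IsCompact K) (hc : Convex ℝ K)
    (hne : (interior K).Nonempty) :
    ∃ h : ℂ ≃ₜ ℂ, h '' closedBall 0 1 = K ∧ h '' sphere 0 1 = frontier K := by
  obtain ⟨e, -, h1, h2⟩ :=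
    exists_homeomorph_image_interior_closure_frontier_eq_unitBall hc hne hK.isBounded
  rw [hK.isClosed.closure_eq] at h1
  refine ⟨e.symm, ?_, ?_⟩
  · rw [← h1, ← image_comp]; simp
  · rw [← h2, ← image_comp]; simp

/-- Two discs in the plane meeting in a nondegenerate connected part of the boundary of the
second one have a disc as their union. -/
theorem exists_disc_union {f g : ℂ → ℂ}
    (hf : ContinuousOn f (closedBall 0 1)) (hfi : InjOn f (closedBall 0 1))
    (hg : ContinuousOn g (closedBall 0 1)) (hgi : InjOn g (closedBall 0 1))
    (hsub : f '' closedBall 0 1 ∩ g '' closedBall 0 1 ⊆ g '' sphere 0 1)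
    (hconn : IsConnected (f '' closedBall 0 1 ∩ g '' closedBall 0 1))
    (hnt : (f '' closedBall 0 1 ∩ g '' closedBall 0 1).Nontrivial) :
    ∃ k : ℂ → ℂ, ContinuousOn k (closedBall 0 1) ∧ InjOn k (closedBall 0 1) ∧
      k '' closedBall 0 1 = f '' closedBall 0 1 ∪ g '' closedBall 0 1 := by
  obtain ⟨α, hα⟩ : ∃ α, α = f '' closedBall 0 1 ∩ g '' closedBall 0 1 := ⟨_, rfl⟩
  rw [← hα] at hsub hconn hnt
  have hfD : IsCompact (f '' closedBall 0 1) :=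
    (isCompact_closedBall 0 1).image_of_continuousOn hf
  have hgD : IsCompact (g '' closedBall 0 1) :=
    (isCompact_closedBall 0 1).image_of_continuousOn hg
  have hαc : IsCompact α := hα ▸ hfD.inter hgD
  have hαf : α ⊆ f '' closedBall 0 1 := hα ▸ inter_subset_left
  have hαg : α ⊆ g '' closedBall 0 1 := hα ▸ inter_subset_right
  have h0 : (0 : ℂ) ∈ closedBall (0 : ℂ) 1 := by simp
  have hmeet : ∀ x ∈ ball (0 : ℂ) 1, g x ∉ f '' closedBall 0 1 := fun x hx h => by
    obtain ⟨y, hy, hyx⟩ := hsub (show g x ∈ α by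
      rw [hα]; exact ⟨h, mem_image_of_mem g (ball_subset_closedBall hx)⟩)
    have := hgi (sphere_subset_closedBall hy) (ball_subset_closedBall hx) hyx
    rw [this, mem_sphere] at hy
    exact (mem_ball.1 hx).ne hy
  have hsubf : α ⊆ f '' sphere 0 1 := by
    intro x hx
    obtain ⟨z, hz, rfl⟩ := hαf hx
    refine mem_image_of_mem f ?_
    by_contra hzS
    have hzb : z ∈ ball (0 : ℂ) 1 := lt_of_le_of_ne hz hzS
    have hnhds := image_closedBall_mem_nhds hf hfi hzb
    obtain ⟨w, hw, hwz⟩ := hsub hx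
    have hcl : w ∈ closure (ball (0 : ℂ) 1) := by
      rw [closure_ball _ one_ne_zero]; exact sphere_subset_closedBall hw
    have hgw : ContinuousWithinAt g (ball 0 1) w :=
      (hg w (sphere_subset_closedBall hw)).mono ball_subset_closedBall
    rw [← hwz] at hnhds
    have := mem_closure_iff_nhdsWithin_neBot.1 hcl
    obtain ⟨y, hyf, hyb⟩ := ((hgw.eventually hnhds).and self_mem_nhdsWithin).exists
    exact hmeet y hyb hyf
  have hneg : α ≠ g '' sphere 0 1 := fun h =>
    hmeet 0 (by simp) (apply_zero_mem_of_image_sphere_subset hg hgi hf hfi (h ▸ hαf))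
  have hnef : α ≠ f '' sphere 0 1 := fun h => by
    have h1 := apply_zero_mem_of_image_sphere_subset hf hfi hg hgi (h ▸ hαg)
    obtain ⟨y, hy, hyx⟩ := hsubf (show f 0 ∈ α by rw [hα]; exact ⟨mem_image_of_mem f h0, h1⟩)
    have := hfi (sphere_subset_closedBall hy) h0 hyx
    simp [this] at hy
  have key : ∀ h : ℂ → ℂ, ContinuousOn h (closedBall 0 1) → InjOn h (closedBall 0 1) →
      α ⊆ h '' sphere 0 1 → α ≠ h '' sphere 0 1 →
      ∃ u : ℂ → ℂ, ContinuousOn u (Icc 0 1 ×ℂ Icc 0 1) ∧ InjOn u (Icc 0 1 ×ℂ Icc 0 1) ∧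
      u '' (Icc 0 1 ×ℂ Icc 0 1) = h '' closedBall 0 1 ∧
      ∀ z ∈ Icc (0 : ℝ) 1 ×ℂ Icc (0 : ℝ) 1, u z ∈ α ↔ z.re = 0 := by
    intro h hh hhi hs hne
    obtain ⟨l, hl, hlh⟩ := exists_continuousOn_leftInvOn (isCompact_closedBall 0 1) hh hhi
    have hs' : α ⊆ h '' closedBall 0 1 := hs.trans (image_mono sphere_subset_closedBall)
    have hlα : l '' α ⊆ sphere 0 1 := by
      rintro _ ⟨x, hx, rfl⟩
      obtain ⟨y, hy, rfl⟩ := hs hx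
      rwa [hlh (sphere_subset_closedBall hy)]
    have hhl : h '' (l '' α) = α := by
      rw [image_image]
      refine (image_congr fun x hx => ?_).trans (image_id α)
      obtain ⟨y, hy, rfl⟩ := hs' hx
      rw [hlh hy]; rfl
    have hlc := hl.mono hs'
    have := exists_square_param hh hhi hlα (hαc.image_of_continuousOn hlc)
      (hconn.image _ hlc) (hnt.image_of_injOn fun x hx y hy hxy => by
        obtain ⟨x', hx', rfl⟩ := hs' hx
        obtain ⟨y', hy', rfl⟩ := hs' hy
        rw [hlh hx', hlh hy'] at hxy
        rw [hxy]) (fun he => hne (by rw [← he, hhl]))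
    rwa [hhl] at this
  obtain ⟨u, hu, hui, huD, huα⟩ := key f hf hfi hsubf hnef
  obtain ⟨v, hv, hvi, hvD, hvα⟩ := key g hg hgi hsub hneg
  obtain ⟨k, hk, hki, hkD⟩ := exists_rectangle_param hu hui hv hvi
    (by rw [huD, hvD, hα]) huα hvα
  obtain ⟨e, he, -⟩ := exists_disc_param_of_convex (K := Icc (-1) 1 ×ℂ Icc 0 1)
    (isCompact_Icc.reProdIm isCompact_Icc)
    (((convex_Icc (-1) 1).linear_preimage Complex.reLm).inter
      ((convex_Icc 0 1).linear_preimage Complex.imLm))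
    ⟨⟨0, 1 / 2⟩, by
      rw [Complex.interior_reProdIm, interior_Icc, interior_Icc, Complex.mem_reProdIm]
      norm_num⟩
  have hem : MapsTo e (closedBall 0 1) (Icc (-1) 1 ×ℂ Icc 0 1) :=
    fun x hx => he ▸ mem_image_of_mem e hx
  refine ⟨k ∘ e, hk.comp e.continuous.continuousOn hem,
    hki.comp e.injective.injOn hem, ?_⟩
  rw [image_comp, he, hkD, huD, hvD]

theorem image_preimage_of_affineSpan_eq
    {E : Type*} [NormedAddCommGroup E] [NormedSpace ℝ E] {F : Set E} {ψ : ℂ →ᵃ[ℝ] E}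
    (hmap : affineSpan ℝ F = (⊤ : AffineSubspace ℝ ℂ).map ψ) : ψ '' (ψ ⁻¹' F) = F := by
  rw [image_preimage_eq_iff]
  intro x hx
  have := subset_affineSpan ℝ F hx
  rw [hmap] at this
  obtain ⟨z, -, hz⟩ := this
  exact ⟨z, hz⟩

theorem exists_planar_chart {E : Type*} [NormedAddCommGroup E] [NormedSpace ℝ E]
    [FiniteDimensional ℝ E] {F : Set E} (hF : Convex ℝ F)
    (hdim : Module.finrank ℝ (affineSpan ℝ F).direction = 2) :
    ∃ ψ : ℂ →ᵃ[ℝ] E, Function.Injective ψ ∧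
      affineSpan ℝ F = (⊤ : AffineSubspace ℝ ℂ).map ψ ∧ (interior (ψ ⁻¹' F)).Nonempty := by
  obtain ⟨p, hp⟩ : F.Nonempty := by
    by_contra h
    rw [not_nonempty_iff_eq_empty] at h
    rw [h, AffineSubspace.span_empty, AffineSubspace.direction_bot] at hdim
    simp at hdim
  let e : ℂ ≃ₗ[ℝ] (affineSpan ℝ F).direction :=
    LinearEquiv.ofFinrankEq _ _ (by rw [hdim, Complex.finrank_real_complex])
  let L : ℂ →ₗ[ℝ] E := (affineSpan ℝ F).direction.subtype ∘ₗ e.toLinearMap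
  let ψ : ℂ →ᵃ[ℝ] E := L.toAffineMap + AffineMap.const ℝ ℂ p
  have hψ : ∀ z, ψ z = (e z : E) + p := fun z => rfl
  have hpA : p ∈ affineSpan ℝ F := subset_affineSpan ℝ F hp
  have hinj : Function.Injective ψ := fun x y h => by
    rw [hψ, hψ] at h
    exact e.injective (Subtype.ext (add_right_cancel h))
  have hmap : affineSpan ℝ F = (⊤ : AffineSubspace ℝ ℂ).map ψ := by
    ext x
    simp only [AffineSubspace.mem_map, AffineSubspace.mem_top, true_and]
    constructor
    · intro hx
      refine ⟨e.symm ⟨x -ᵥ p, AffineSubspace.vsub_mem_direction hx hpA⟩, ?_⟩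
      rw [hψ, e.apply_symm_apply]
      simp
    · rintro ⟨z, rfl⟩
      exact AffineSubspace.vadd_mem_of_mem_direction (e z).2 hpA
  refine ⟨ψ, hinj, hmap, ?_⟩
  rw [(hF.affine_preimage ψ).interior_nonempty_iff_affineSpan_eq_top]
  have himg := image_preimage_of_affineSpan_eq hmap
  have h := AffineSubspace.map_span ψ (ψ ⁻¹' F)
  rw [himg, hmap] at h
  refine SetLike.coe_injective (hinj.image_injective ?_)
  simpa using congrArg (fun S : AffineSubspace ℝ E => (S : Set E)) h

section Chart

variable {E : Type*} [NormedAddCommGroup E] [NormedSpace ℝ E]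
  {F : Set E} {ψ : ℂ →ᵃ[ℝ] E}

theorem isCompact_preimage_of_injective (hF : IsCompact F) (hψ : Function.Injective ψ) :
    IsCompact (ψ ⁻¹' F) := by
  have hlin : Function.Injective ψ.linear := (AffineMap.linear_injective_iff ψ).2 hψ
  have hemb : Topology.IsClosedEmbedding ψ.linear :=
    LinearMap.isClosedEmbedding_of_injective (LinearMap.ker_eq_bot.2 hlin)
  have h2 : (ψ : ℂ → E) = (Homeomorph.addRight (ψ 0)) ∘ ψ.linear := by
    ext z
    have := ψ.map_vadd 0 z
    simpa using this
  have : Topology.IsClosedEmbedding ψ := by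
    rw [h2]; exact (Homeomorph.addRight (ψ 0)).isClosedEmbedding.comp hemb
  exact this.isCompact_preimage hF

theorem map_direction_eq_zero_of_isMax
    (hmap : affineSpan ℝ F = (⊤ : AffineSubspace ℝ ℂ).map ψ) {z : ℂ}
    (hz : z ∈ interior (ψ ⁻¹' F)) {l : StrongDual ℝ E} (hl : ∀ y ∈ F, l y ≤ l (ψ z)) :
    ∀ v ∈ (affineSpan ℝ F).direction, l v = 0 := by
  have hmax : IsLocalMax (fun w => l (ψ w)) z := by
    filter_upwards [mem_interior_iff_mem_nhds.1 hz] with w hw using hl _ hw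
  let L : ℂ →L[ℝ] ℝ := l.comp (LinearMap.toContinuousLinearMap ψ.linear)
  have hfun : (fun w => l (ψ w)) = fun w => L w + l (ψ 0) := by
    ext w
    have := ψ.map_vadd 0 w
    simp only [vadd_eq_add, add_zero] at this
    rw [this, map_add]; rfl
  rw [hfun] at hmax
  have h0 : L = 0 := hmax.hasFDerivAt_eq_zero (L.hasFDerivAt.add_const _)
  intro v hv
  rw [hmap, AffineSubspace.map_direction] at hv
  obtain ⟨w, -, rfl⟩ := hv
  exact DFunLike.congr_fun h0 w

theorem subset_of_isExposed_of_mem_interior {Q G : Set E} (hFQ : F ⊆ Q)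
    (hmap : affineSpan ℝ F = (⊤ : AffineSubspace ℝ ℂ).map ψ) {z : ℂ}
    (hz : z ∈ interior (ψ ⁻¹' F)) (hG : IsExposed ℝ Q G) (hzG : ψ z ∈ G) : F ⊆ G := by
  obtain ⟨l, hl⟩ := hG ⟨_, hzG⟩
  rw [hl] at hzG
  have h0 := map_direction_eq_zero_of_isMax hmap hz fun y hy => hzG.2 y (hFQ hy)
  have hzF : z ∈ ψ ⁻¹' F := interior_subset hz
  intro x hx
  rw [hl]
  refine ⟨hFQ hx, fun y hy => ?_⟩
  have := h0 (x -ᵥ ψ z) (AffineSubspace.vsub_mem_direction (subset_affineSpan ℝ F hx)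
    (subset_affineSpan ℝ F hzF))
  rw [vsub_eq_sub, map_sub, sub_eq_zero] at this
  rw [this]
  exact hzG.2 y hy

end Chart

theorem IsExposed.eq_of_subset_of_finrank_eq {E : Type*} [NormedAddCommGroup E]
    [NormedSpace ℝ E] [FiniteDimensional ℝ E] {Q F G : Set E} (hF : IsExposed ℝ Q F)
    (hG : IsExposed ℝ Q G) (hne : F.Nonempty) (hFG : F ⊆ G)
    (hdim : Module.finrank ℝ (affineSpan ℝ F).direction =
      Module.finrank ℝ (affineSpan ℝ G).direction) : F = G := by
  refine hFG.antisymm fun x hx => ?_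
  obtain ⟨p, hp⟩ := hne
  obtain ⟨l, hl⟩ := hF ⟨p, hp⟩
  have hdir : (affineSpan ℝ F).direction = (affineSpan ℝ G).direction :=
    Submodule.eq_of_le_of_finrank_eq (AffineSubspace.direction_le (affineSpan_mono ℝ hFG)) hdim
  have hle : (affineSpan ℝ F).direction ≤ LinearMap.ker l.toLinearMap := by
    rw [direction_affineSpan, vectorSpan_def, Submodule.span_le]
    rintro _ ⟨a, ha, b, hb, rfl⟩
    rw [hl] at ha hb
    simp [le_antisymm (hb.2 a ha.1) (ha.2 b hb.1)]
  have h := AffineSubspace.vsub_mem_direction (subset_affineSpan ℝ G hx)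
    (subset_affineSpan ℝ G (hFG hp))
  rw [← hdir] at h
  have := hle h
  simp only [vsub_eq_sub, LinearMap.mem_ker, map_sub, sub_eq_zero,
    ContinuousLinearMap.coe_coe] at this
  rw [hl] at hp ⊢
  exact ⟨hG.subset hx, fun y hy => this ▸ hp.2 y hy⟩

theorem eq_of_mem_frontier_of_smul_sub_eq {E : Type*} [NormedAddCommGroup E]
    [NormedSpace ℝ E] {Q : Set E} (hQ : Convex ℝ Q) {c x y : E} (hc : c ∈ interior Q)
    (hx : x ∈ frontier Q) (hy : y ∈ frontier Q) {r : ℝ} (hr : 0 < r)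
    (h : y - c = r • (x - c)) : x = y := by
  have aux : ∀ x ∈ frontier Q, ∀ y ∈ frontier Q, ∀ r : ℝ, 0 < r → r < 1 →
      y - c = r • (x - c) → False := by
    intro x hx y hy r hr hr1 h
    refine hy.2 (hQ.openSegment_interior_closure_subset_interior hc hx.1
      ⟨1 - r, r, sub_pos.2 hr1, hr, by ring, ?_⟩)
    rw [eq_add_of_sub_eq h]; module
  rcases lt_trichotomy r 1 with h1 | h1 | h1
  · exact (aux x hx y hy r hr h1 h).elim
  · rw [h1, one_smul] at h
    exact (sub_left_injective h).symm
  · refine (aux y hy x hx r⁻¹ (inv_pos.2 hr) (inv_lt_one_of_one_lt₀ h1) ?_).elim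
    rw [h, smul_smul, inv_mul_cancel₀ hr.ne', one_smul]

theorem exists_planar_embedding {Q : Set (Fin 3 → ℝ)} (hQ : Convex ℝ Q)
    (hint : (interior Q).Nonempty) {p : Fin 3 → ℝ} (hp : p ∈ frontier Q) :
    ∃ φ : (Fin 3 → ℝ) → ℂ,
      ContinuousOn φ (frontier Q \ {p}) ∧ InjOn φ (frontier Q \ {p}) := by
  obtain ⟨c, hc⟩ := hint
  let w : (Fin 3 → ℝ) → EuclideanSpace ℝ (Fin 3) := fun x => WithLp.toLp 2 (x - c)
  have hw : Continuous w := by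
    have := PiLp.continuous_toLp 2 (fun _ : Fin 3 => ℝ)
    fun_prop
  have hw0 : ∀ x ∈ frontier Q, w x ≠ 0 := by
    intro x hx h
    have : x = c := by
      have := congrArg (WithLp.ofLp) h
      simpa [w, sub_eq_zero] using this
    exact hx.2 (this ▸ hc)
  let ρ : (Fin 3 → ℝ) → EuclideanSpace ℝ (Fin 3) := fun x => ‖w x‖⁻¹ • w x
  have hρn : ∀ x ∈ frontier Q, ‖ρ x‖ = 1 := fun x hx => by
    rw [norm_smul, norm_inv, norm_norm, inv_mul_cancel₀ (norm_ne_zero_iff.2 (hw0 x hx))]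
  have hρc : ContinuousOn ρ (frontier Q) :=
    (hw.norm.continuousOn.inv₀ fun x hx => norm_ne_zero_iff.2 (hw0 x hx)).smul hw.continuousOn
  have hρi : InjOn ρ (frontier Q) := by
    intro x hx y hy hxy
    have hxn := norm_pos_iff.2 (hw0 x hx)
    have hyn := norm_pos_iff.2 (hw0 y hy)
    refine eq_of_mem_frontier_of_smul_sub_eq hQ hc hx hy
      (mul_pos hyn (inv_pos.2 hxn)) ?_
    have : w y = (‖w y‖ * ‖w x‖⁻¹) • w x := by
      rw [mul_smul]
      change _ = ‖w y‖ • ρ x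
      rw [hxy, smul_smul, mul_inv_cancel₀ hyn.ne', one_smul]
    exact congrArg WithLp.ofLp this
  have hv := hρn p hp
  have hinner : ∀ x ∈ frontier Q \ {p}, innerSL ℝ (ρ p) (ρ x) ≠ (1 : ℝ) := by
    intro x hx h
    exact hx.2 (hρi hp hx.1 ((inner_eq_one_iff_of_norm_eq_one hv (hρn x hx.1)).1 h)).symm
  have hfin : Module.finrank ℝ (ℝ ∙ ρ p)ᗮ = 2 := by
    have : Fact (Module.finrank ℝ (EuclideanSpace ℝ (Fin 3)) = 2 + 1) := ⟨by simp⟩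
    exact Submodule.finrank_orthogonal_span_singleton (norm_ne_zero_iff.1 (by rw [hv]; simp))
  let e : (ℝ ∙ ρ p)ᗮ ≃L[ℝ] ℂ :=
    ContinuousLinearEquiv.ofFinrankEq (by rw [hfin, Complex.finrank_real_complex])
  refine ⟨fun x => e (stereoToFun (ρ p) (ρ x)), ?_, ?_⟩
  · exact e.continuous.comp_continuousOn
      ((continuousOn_stereoToFun (v := ρ p)).comp (hρc.mono sdiff_subset) hinner)
  · intro x hx y hy hxy
    have h := e.injective hxy
    have hne : ∀ a (ha : a ∈ frontier Q \ {p}),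
        (⟨ρ a, by simpa using hρn a ha.1⟩ : sphere (0 : EuclideanSpace ℝ (Fin 3)) 1) ∈
          (stereographic hv).source := by
      intro a ha
      simp only [stereographic_source, mem_compl_iff, mem_singleton_iff]
      intro h
      exact ha.2 (hρi ha.1 hp (congrArg Subtype.val h))
    have := (stereographic hv).injOn (hne x hx) (hne y hy) h
    exact hρi hx.1 hy.1 (congrArg Subtype.val this)

theorem exists_disc_param_of_finrank_eq_two {E : Type*} [NormedAddCommGroup E]
    [NormedSpace ℝ E] [FiniteDimensional ℝ E] {F : Set E} (hFc : IsCompact F)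
    (hF : Convex ℝ F) (hdim : Module.finrank ℝ (affineSpan ℝ F).direction = 2) :
    ∃ γ : ℂ → E, Continuous γ ∧ Function.Injective γ ∧ γ '' closedBall 0 1 = F ∧
      ∀ G, IsExposed ℝ F G → Module.finrank ℝ (affineSpan ℝ G).direction = 1 →
        G ⊆ γ '' sphere 0 1 := by
  obtain ⟨ψ, hψ, hmap, hint⟩ := exists_planar_chart hF hdim
  have himg := image_preimage_of_affineSpan_eq hmap
  obtain ⟨h, hh, hhs⟩ := exists_disc_param_of_convex (isCompact_preimage_of_injective hFc hψ)
    (hF.affine_preimage ψ) hint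
  refine ⟨ψ ∘ h, ψ.continuous_of_finiteDimensional.comp h.continuous, hψ.comp h.injective,
    by rw [image_comp, hh, himg], fun G hG hGdim x hx => ?_⟩
  rw [image_comp, hhs]
  have hxF := hG.subset hx
  rw [← himg] at hxF
  obtain ⟨z, hz, rfl⟩ := hxF
  refine mem_image_of_mem ψ ⟨subset_closure hz, fun hzi => ?_⟩
  have := (subset_of_isExposed_of_mem_interior Subset.rfl hmap hzi hG hx).antisymm hG.subset
  rw [this] at hdim
  omega

theorem exists_mem_forall_isExposed_subset {E : Type*} [NormedAddCommGroup E]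
    [NormedSpace ℝ E] [FiniteDimensional ℝ E] {Q F : Set E} (hFQ : F ⊆ Q) (hF : Convex ℝ F)
    (hdim : Module.finrank ℝ (affineSpan ℝ F).direction = 2) :
    ∃ p ∈ F, ∀ G, IsExposed ℝ Q G → p ∈ G → F ⊆ G := by
  obtain ⟨ψ, hψ, hmap, z, hz⟩ := exists_planar_chart hF hdim
  exact ⟨ψ z, interior_subset (s := ψ ⁻¹' F) hz,
    fun G hG => subset_of_isExposed_of_mem_interior hFQ hmap hz hG⟩

theorem nontrivial_of_finrank_direction_eq_one {E : Type*} [NormedAddCommGroup E]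
    [NormedSpace ℝ E] {G : Set E}
    (hdim : Module.finrank ℝ (affineSpan ℝ G).direction = 1) : G.Nontrivial := by
  by_contra h
  rw [not_nontrivial_iff] at h
  rw [direction_affineSpan, vectorSpan_of_subsingleton ℝ h, finrank_bot] at hdim
  omega

theorem IsCompact.nonempty_homeomorph_image {X Y : Type*} [TopologicalSpace X]
    [TopologicalSpace Y] [T2Space Y] {K : Set X} (hK : IsCompact K) {f : X → Y}
    (hf : ContinuousOn f K) (hi : InjOn f K) : Nonempty (K ≃ₜ f '' K) := by
  have := isCompact_iff_compactSpace.1 hK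
  exact ⟨Continuous.homeoOfEquivCompactToT2 (f := Equiv.Set.imageOfInjOn f K hi)
    (hf.mapsToRestrict (mapsTo_image f K))⟩

theorem nonempty_homeomorph_closedBall {E : Type*} [TopologicalSpace E] [T2Space E] {U : Set E}
    (hU : IsCompact U) {φ : E → ℂ} (hφ : ContinuousOn φ U) (hφi : InjOn φ U) {f : ℂ → ℂ}
    (hf : ContinuousOn f (closedBall 0 1)) (hfi : InjOn f (closedBall 0 1))
    (h : f '' closedBall 0 1 = φ '' U) :
    Nonempty (U ≃ₜ closedBall (0 : EuclideanSpace ℝ (Fin 2)) 1) := by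
  obtain ⟨e₁⟩ := hU.nonempty_homeomorph_image hφ hφi
  obtain ⟨e₂⟩ := (isCompact_closedBall (0 : ℂ) 1).nonempty_homeomorph_image hf hfi
  let r := Complex.orthonormalBasisOneI.repr
  have e₃ : closedBall (0 : ℂ) 1 ≃ₜ closedBall (0 : EuclideanSpace ℝ (Fin 2)) 1 :=
    (r.toHomeomorph.image _).trans (Homeomorph.setCongr (by
      have := r.image_closedBall 0 1
      rw [map_zero] at this
      exact this))
  exact ⟨(e₁.trans (Homeomorph.setCongr h.symm)).trans (e₂.symm.trans e₃)⟩

/-- If `D_1, …, D_t` is a partial shelling of the facets of a 3-polytope `Q` (each new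
facet meets the union of the previous ones in a nonempty connected union of its edges),
then the union `|D_I|` is homeomorphic to a closed 2-dimensional disk. -/
theorem stmt_16 (V : Finset (Fin 3 → ℝ)) (Q : Set (Fin 3 → ℝ))
    (hQ : Q = convexHull ℝ ↑V) (hfull : (interior Q).Nonempty)
    (s t : ℕ) (ht : 1 ≤ t) (hts : t < s)
    (F : Fin s → Set (Fin 3 → ℝ))
    (hface : ∀ i, IsExposed ℝ Q (F i))
    (hdim : ∀ i, Module.finrank ℝ (affineSpan ℝ (F i)).direction = 2)
    (hFinj : Function.Injective F)
    (hcover : frontier Q = ⋃ i, F i)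
    (σ : Fin t → Fin s) (hσ : Function.Injective σ)
    (hshell : ∀ i : Fin t, 0 < (i : ℕ) →
      ((⋃ j : Fin t, ⋃ _ : j < i, F (σ j)) ∩ F (σ i)).Nonempty ∧
      IsConnected ((⋃ j : Fin t, ⋃ _ : j < i, F (σ j)) ∩ F (σ i)) ∧
      ∃ 𝒢 : Set (Set (Fin 3 → ℝ)),
        (∀ g ∈ 𝒢, IsExposed ℝ (F (σ i)) g ∧
          Module.finrank ℝ (affineSpan ℝ g).direction = 1) ∧
        (⋃ j : Fin t, ⋃ _ : j < i, F (σ j)) ∩ F (σ i) = ⋃₀ 𝒢) :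
    Nonempty ((⋃ i : Fin t, F (σ i)) ≃ₜ
      (Metric.closedBall (0 : EuclideanSpace ℝ (Fin 2)) 1)) := by
  have hQc : IsCompact Q := hQ ▸ V.finite_toSet.isCompact_convexHull ℝ
  have hQconv : Convex ℝ Q := hQ ▸ convex_convexHull ℝ _
  have hFc : ∀ i, IsCompact (F i) := fun i => (hface i).isCompact hQc
  have hFconv : ∀ i, Convex ℝ (F i) := fun i => (hface i).convex hQconv
  obtain ⟨k, hk⟩ : ∃ k, k ∉ range σ := by
    by_contra! h
    have := Fintype.card_le_of_surjective σ h
    simp at this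
    omega
  obtain ⟨p, hp, hpG⟩ :=
    exists_mem_forall_isExposed_subset (hface k).subset (hFconv k) (hdim k)
  have hpU : p ∉ ⋃ i, F (σ i) := by
    rw [mem_iUnion]
    rintro ⟨i, hi⟩
    refine hk ⟨i, (hFinj ?_).symm⟩
    exact (hface k).eq_of_subset_of_finrank_eq (hface _) ⟨p, hp⟩ (hpG _ (hface _) hi)
      (by rw [hdim, hdim])
  obtain ⟨φ, hφ, hφi⟩ := exists_planar_embedding hQconv hfull
    (hcover ▸ mem_iUnion_of_mem k hp : p ∈ frontier Q)
  have hUsub : ⋃ i, F (σ i) ⊆ frontier Q \ {p} := fun x hx =>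
    ⟨by
      obtain ⟨i, hi⟩ := mem_iUnion.1 hx
      rw [hcover]
      exact mem_iUnion_of_mem _ hi, fun h => hpU (h ▸ hx)⟩
  replace hφ := hφ.mono hUsub
  replace hφi := hφi.mono hUsub
  have hdisc : ∀ i, ∃ g : ℂ → ℂ, ContinuousOn g (closedBall 0 1) ∧ InjOn g (closedBall 0 1) ∧
      g '' closedBall 0 1 = φ '' F (σ i) ∧ ∀ G, IsExposed ℝ (F (σ i)) G →
        Module.finrank ℝ (affineSpan ℝ G).direction = 1 → φ '' G ⊆ g '' sphere 0 1 := by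
    intro i
    obtain ⟨γ, hγ, hγi, hγD, hγG⟩ :=
      exists_disc_param_of_finrank_eq_two (hFc (σ i)) (hFconv _) (hdim _)
    have hm : MapsTo γ (closedBall 0 1) (⋃ i, F (σ i)) := fun x hx =>
      mem_iUnion_of_mem i (hγD ▸ mem_image_of_mem γ hx)
    exact ⟨φ ∘ γ, hφ.comp hγ.continuousOn hm, hφi.comp hγi.injOn hm,
      by rw [image_comp, hγD], fun G hG hG1 => by
        rw [image_comp]; exact image_mono (hγG G hG hG1)⟩
  have main : ∀ n, 1 ≤ n → n ≤ t → ∃ f : ℂ → ℂ, ContinuousOn f (closedBall 0 1) ∧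
      InjOn f (closedBall 0 1) ∧
      f '' closedBall 0 1 = φ '' ⋃ j : Fin t, ⋃ _ : (j : ℕ) < n, F (σ j) := by
    intro n hn
    induction n, hn using Nat.le_induction with
    | base =>
      intro h1
      obtain ⟨g, hg, hgi, hgD, -⟩ := hdisc ⟨0, h1⟩
      refine ⟨g, hg, hgi, hgD.trans (congrArg _ ?_)⟩
      ext x
      simp only [mem_iUnion, Nat.lt_one_iff, exists_prop]
      exact ⟨fun h => ⟨_, rfl, h⟩, fun ⟨j, hj, h⟩ => by
        rwa [show j = ⟨0, h1⟩ from Fin.ext hj] at h⟩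
    | succ n hn ih =>
      intro hnt
      obtain ⟨f, hf, hfi, hfD⟩ := ih (by omega)
      let i : Fin t := ⟨n, hnt⟩
      obtain ⟨g, hg, hgi, hgD, hgG⟩ := hdisc i
      obtain ⟨-, hconn, 𝒢, h𝒢, hU𝒢⟩ := hshell i hn
      obtain ⟨B, hB⟩ : ∃ B, B = ⋃ j : Fin t, ⋃ _ : j < i, F (σ j) := ⟨_, rfl⟩
      rw [← hB] at hconn hU𝒢
      replace hfD : f '' closedBall 0 1 = φ '' B := by rw [hfD, hB]; rfl
      have hBU : B ⊆ ⋃ i, F (σ i) := by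
        rw [hB]
        exact iUnion_mono fun j => iUnion_subset fun _ => Subset.rfl
      have hFU : F (σ i) ⊆ ⋃ i, F (σ i) := subset_iUnion (fun i => F (σ i)) i
      have hinter : f '' closedBall 0 1 ∩ g '' closedBall 0 1 = φ '' (B ∩ F (σ i)) := by
        rw [hfD, hgD, hφi.image_inter hBU hFU]
      have hIU : B ∩ F (σ i) ⊆ ⋃ i, F (σ i) := inter_subset_left.trans hBU
      obtain ⟨k, hk, hki, hkD⟩ := exists_disc_union hf hfi hg hgi
        (by
          rw [hinter, hU𝒢, sUnion_eq_biUnion, image_iUnion₂]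
          exact iUnion₂_subset fun G hG => hgG G (h𝒢 G hG).1 (h𝒢 G hG).2)
        (by rw [hinter]; exact hconn.image _ (hφ.mono hIU))
        (by
          rw [hinter]
          refine Nontrivial.image_of_injOn ?_ (hφi.mono hIU)
          obtain ⟨x, hx⟩ := hconn.nonempty
          rw [hU𝒢] at hx ⊢
          obtain ⟨G, hG, -⟩ := hx
          exact (nontrivial_of_finrank_direction_eq_one (h𝒢 G hG).2).mono
            (subset_sUnion_of_mem hG))
      refine ⟨k, hk, hki, hkD.trans ?_⟩
      rw [hfD, hgD, ← image_union, hB]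
      congr 1
      ext x
      simp only [mem_union, mem_iUnion, exists_prop]
      constructor
      · rintro (⟨j, hj, h⟩ | h)
        · exact ⟨j, Nat.lt_succ_of_lt hj, h⟩
        · exact ⟨i, Nat.lt_succ_self n, h⟩
      · rintro ⟨j, hj, h⟩
        rcases Nat.lt_succ_iff_lt_or_eq.1 hj with hj | hj
        · exact Or.inl ⟨j, hj, h⟩
        · exact Or.inr (by rwa [show j = i from Fin.ext hj] at h)
  obtain ⟨f, hf, hfi, hfD⟩ := main t ht le_rfl
  refine nonempty_homeomorph_closedBall (isCompact_iUnion fun i => hFc (σ i)) hφ hφi hf hfi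
    (hfD.trans (congrArg _ ?_))
  simp
end
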